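/- arXiv:1706.02343 — 4 statements merged into one kernel-verified Lean document; each statement's English description precedes it below -/
import Mathlib

section
/- Let I ⊆ ℝ be a nondegenerate interval whose left endpoint a belongs to I, and let f : I → ℝ be continuous. Then f is operator monotone on I if and only if the function g defined on I \ {a} by g(x) = (f(x) − f(a))/(x − a) is strongly operator convex on I \ {a}. -/
open Matrix Set
open scoped ComplexOrder

/-- `f` is operator monotone on `I ⊆ ℝ`: for every `n ≥ 1` and all `n×n` Hermitian complex
matrices `A, B` with spectra (eigenvalues) contained in `I`, `A ≤ B` in the Loewner order
implies `f(A) ≤ f(B)`, where `f(A)` is given by the functional calculus. -/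
def OperatorMonotoneOn (f : ℝ → ℝ) (I : Set ℝ) : Prop :=
  ∀ (n : ℕ), 0 < n → ∀ (A B : Matrix (Fin n) (Fin n) ℂ)
    (hA : A.IsHermitian) (hB : B.IsHermitian),
    (∀ i, hA.eigenvalues i ∈ I) → (∀ i, hB.eigenvalues i ∈ I) →
    (B - A).PosSemidef → (hB.cfc f - hA.cfc f).PosSemidef

/-- `f` is operator convex on `I ⊆ ℝ`: for every `n ≥ 1`, every `t ∈ [0,1]` and all `n×n`
Hermitian complex matrices `A, B` with spectra contained in `I`,
`f(tA + (1−t)B) ≤ t·f(A) + (1−t)·f(B)` in the Loewner order. -/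
def OperatorConvexOn (f : ℝ → ℝ) (I : Set ℝ) : Prop :=
  ∀ (n : ℕ), 0 < n → ∀ t : ℝ, t ∈ Set.Icc (0 : ℝ) 1 →
  ∀ (A B : Matrix (Fin n) (Fin n) ℂ) (hA : A.IsHermitian) (hB : B.IsHermitian)
    (hAB : ((t : ℂ) • A + ((1 : ℂ) - (t : ℂ)) • B).IsHermitian),
    (∀ i, hA.eigenvalues i ∈ I) → (∀ i, hB.eigenvalues i ∈ I) →
    ((t : ℂ) • hA.cfc f + ((1 : ℂ) - (t : ℂ)) • hB.cfc f - hAB.cfc f).PosSemidef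

/-- `f` is strongly operator convex on `I ⊆ ℝ`: there is `x₀ ∈ I` such that for every `n ≥ 1`,
every `n×n` orthogonal projection `P` and every `n×n` Hermitian matrix `H` with spectrum
contained in `I`, `P·f(PHP + x₀(1−P))·P ≤ f(H)` in the Loewner order. -/
def StronglyOperatorConvexOn (f : ℝ → ℝ) (I : Set ℝ) : Prop :=
  ∃ x₀ ∈ I, ∀ (n : ℕ), 0 < n → ∀ (P H : Matrix (Fin n) (Fin n) ℂ),
    P.IsHermitian → P * P = P →
    ∀ (hH : H.IsHermitian)
      (hK : (P * H * P + (x₀ : ℂ) • ((1 : Matrix (Fin n) (Fin n) ℂ) - P)).IsHermitian),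
    (∀ i, hH.eigenvalues i ∈ I) →
    (hH.cfc f - P * hK.cfc f * P).PosSemidef

open scoped MatrixOrder Topology

section FunctionalCalculus

variable {m n : Type*} [Fintype m] [DecidableEq m] [Fintype n] [DecidableEq n]

theorem Matrix.continuousOn_real_spectrum (f : ℝ → ℝ) (M : Matrix n n ℂ) :
    ContinuousOn f (spectrum ℝ M) :=
  M.finite_real_spectrum.continuousOn f

theorem Matrix.isHermitian_cfc (f : ℝ → ℝ) (M : Matrix n n ℂ) : (cfc f M).IsHermitian :=
  (cfc_predicate f M : IsSelfAdjoint (cfc f M))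

omit [Fintype n] in
theorem Matrix.isHermitian_real_smul_one (c : ℝ) : (c • (1 : Matrix n n ℂ)).IsHermitian :=
  isHermitian_one.smul (IsSelfAdjoint.all c)

/-- The functional calculus respects intertwining relations. -/
theorem Matrix.cfc_mul_eq_mul_cfc (f : ℝ → ℝ) {M : Matrix m m ℂ} {N : Matrix n n ℂ}
    (hM : M.IsHermitian) (hN : N.IsHermitian) {X : Matrix m n ℂ} (h : M * X = X * N) :
    cfc f M * X = X * cfc f N := by
  classical
  obtain ⟨p, hp⟩ : ∃ p : Polynomial ℝ, ∀ x ∈ spectrum ℝ M ∪ spectrum ℝ N, p.eval x = f x := by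
    let s := (M.finite_real_spectrum.union N.finite_real_spectrum).toFinset
    refine ⟨Lagrange.interpolate s id f, fun x hx => ?_⟩
    exact Lagrange.eval_interpolate_at_node (v := id) f Function.injective_id.injOn
      ((Set.Finite.mem_toFinset _).2 hx)
  rw [cfc_congr (g := p.eval) fun x hx => (hp x (Or.inl hx)).symm,
    cfc_congr (a := N) (g := p.eval) fun x hx => (hp x (Or.inr hx)).symm,
    show cfc (fun x => p.eval x) M = _ from cfc_polynomial p M hM,
    show cfc (fun x => p.eval x) N = _ from cfc_polynomial p N hN]
  clear hp
  induction p using Polynomial.induction_on' with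
  | add p q hp hq => simp only [map_add, Matrix.add_mul, Matrix.mul_add, hp, hq]
  | monomial k c =>
    have hk : M ^ k * X = X * N ^ k := by
      induction k with
      | zero => simp
      | succ k ih => rw [pow_succ, pow_succ', Matrix.mul_assoc, h, ← Matrix.mul_assoc, ih,
          Matrix.mul_assoc, ← pow_succ, ← pow_succ']
    simp only [Polynomial.aeval_monomial, Algebra.algebraMap_eq_smul_one, smul_mul_assoc, one_mul,
      Matrix.smul_mul, Matrix.mul_smul, hk]

theorem Matrix.IsHermitian.smul_one_le_iff {M : Matrix n n ℂ} (hM : M.IsHermitian) {c : ℝ} :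
    c • (1 : Matrix n n ℂ) ≤ M ↔ ∀ x ∈ spectrum ℝ M, c ≤ x := by
  rw [← Algebra.algebraMap_eq_smul_one]
  exact algebraMap_le_iff_le_spectrum hM

theorem Matrix.IsHermitian.le_smul_one_iff {M : Matrix n n ℂ} (hM : M.IsHermitian) {c : ℝ} :
    M ≤ c • (1 : Matrix n n ℂ) ↔ ∀ x ∈ spectrum ℝ M, x ≤ c := by
  rw [← Algebra.algebraMap_eq_smul_one]
  exact le_algebraMap_iff_spectrum_le hM

omit [Fintype n] in
theorem Matrix.isHermitian_of_smul_one_le {M : Matrix n n ℂ} {c : ℝ}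
    (h : c • (1 : Matrix n n ℂ) ≤ M) : M.IsHermitian := by
  have := (le_iff.1 h).isHermitian.add (isHermitian_real_smul_one c)
  rwa [sub_add_cancel] at this

theorem Matrix.cfc_sqrt_mul_self {M : Matrix n n ℂ} {f : ℝ → ℝ}
    (hf : ∀ x ∈ spectrum ℝ M, 0 ≤ f x) :
    cfc (fun x => √(f x)) M * cfc (fun x => √(f x)) M = cfc f M := by
  rw [← cfc_mul _ _ M (continuousOn_real_spectrum _ M) (continuousOn_real_spectrum _ M)]
  exact cfc_congr fun x hx => Real.mul_self_sqrt (hf x hx)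

theorem Matrix.IsHermitian.cfc_sub_const {M : Matrix n n ℂ} (hM : M.IsHermitian) (f : ℝ → ℝ)
    (c : ℝ) : cfc (fun x => f x - c) M = cfc f M - c • 1 := by
  have hM' : IsSelfAdjoint M := hM
  rw [cfc_sub f (fun _ => c) M (continuousOn_real_spectrum _ M) (continuousOn_real_spectrum _ M),
    cfc_const c M hM', Algebra.algebraMap_eq_smul_one]

/-- For Hermitian `H ≥ a`, there is a Hermitian square root of `H - a`. -/
theorem Matrix.exists_isHermitian_mul_self_eq_sub {H : Matrix n n ℂ} {a : ℝ}
    (h : a • (1 : Matrix n n ℂ) ≤ H) :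
    ∃ S : Matrix n n ℂ, S.IsHermitian ∧ S * S = H - a • 1 := by
  have hH := isHermitian_of_smul_one_le h
  have hH' : IsSelfAdjoint H := hH
  refine ⟨cfc (fun x => √(x - a)) H, isHermitian_cfc _ _, ?_⟩
  rw [cfc_sqrt_mul_self fun x hx => sub_nonneg.2 (hH.smul_one_le_iff.1 h x hx),
    hH.cfc_sub_const (fun x => x), cfc_id' ℝ H hH']

/-- The functional calculus of a divided difference. -/
theorem Matrix.IsHermitian.sub_smul_one_mul_cfc_slope {M : Matrix n n ℂ} (hM : M.IsHermitian)
    (f : ℝ → ℝ) (a : ℝ) :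
    (M - a • 1) * cfc (fun x => (f x - f a) / (x - a)) M = cfc f M - f a • 1 := by
  have hM' : IsSelfAdjoint M := hM
  have h1 : M - a • 1 = cfc (fun x => x - a) M := by
    rw [hM.cfc_sub_const (fun x => x), cfc_id' ℝ M hM']
  rw [h1, ← cfc_mul _ _ M (continuousOn_real_spectrum _ M) (continuousOn_real_spectrum _ M),
    ← hM.cfc_sub_const f]
  refine cfc_congr fun x _ => ?_
  rcases eq_or_ne x a with rfl | hx
  · simp
  · exact mul_div_cancel₀ _ (sub_ne_zero.2 hx)

theorem Matrix.isHermitian_compress_add {P H : Matrix n n ℂ} (hP : P.IsHermitian)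
    (hH : H.IsHermitian) (c : ℝ) : (P * H * P + c • (1 - P)).IsHermitian := by
  refine IsHermitian.add ?_ ((isHermitian_one.sub hP).smul (IsSelfAdjoint.all c))
  simpa [hP.eq] using isHermitian_mul_mul_conjTranspose P hH

/-- If `S ^ 2 = H - a` and `P` is a projection, then conjugating the defect of strong operator
convexity of `x ↦ (f x - f a) / (x - a)` by `S` yields `f(H) - f(SPS + a)`. -/
theorem Matrix.mul_slope_defect_mul {P H S : Matrix n n ℂ} (hP : P.IsHermitian) (hPP : P * P = P)
    (hH : H.IsHermitian) (hS : S.IsHermitian) {a : ℝ} (hSS : S * S = H - a • 1) (x₀ : ℝ)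
    (f : ℝ → ℝ) :
    S * (cfc (fun x => (f x - f a) / (x - a)) H -
        P * cfc (fun x => (f x - f a) / (x - a)) (P * H * P + x₀ • (1 - P)) * P) * S =
      cfc f H - cfc f (S * P * S + a • 1) := by
  set g : ℝ → ℝ := fun x => (f x - f a) / (x - a)
  set K := P * H * P + x₀ • (1 - P) with hKdef
  set T := S * P * S + a • 1 with hTdef
  have hK : K.IsHermitian := isHermitian_compress_add hP hH x₀
  have hT : T.IsHermitian := by
    refine IsHermitian.add ?_ (isHermitian_real_smul_one a)
    simpa [hS.eq] using isHermitian_mul_mul_conjTranspose S hP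
  have hHS : H = S * S + a • 1 := by rw [hSS, sub_add_cancel]
  have h1 : cfc g H * S = S * cfc g H := by
    refine cfc_mul_eq_mul_cfc g hH hH ?_
    rw [hHS]; simp [add_mul, mul_add, mul_assoc]
  have h2 : cfc g K * (P * S) = P * S * cfc g T := by
    refine cfc_mul_eq_mul_cfc g hK hT ?_
    rw [hKdef, hTdef, hHS]
    have e : (1 - P) * (P * S) = 0 := by rw [← mul_assoc, sub_mul, hPP]; simp
    have e1 : P * (P * S) = P * S := by rw [← mul_assoc, hPP]
    have e2 : P * (S * S + a • 1) * P * (P * S) = P * S * (S * P * S + a • 1) := by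
      simp only [add_mul, mul_add, mul_assoc, e1, mul_smul_comm, smul_mul_assoc, mul_one]
    rw [add_mul, smul_mul_assoc, e, smul_zero, add_zero, e2]
  calc S * (cfc g H - P * cfc g K * P) * S
      = S * (cfc g H * S) - S * P * (cfc g K * (P * S)) := by
        simp only [mul_sub, sub_mul, mul_assoc]
    _ = (S * S) * cfc g H - S * (P * P) * S * cfc g T := by
        rw [h1, h2]; simp only [mul_assoc]
    _ = (H - a • 1) * cfc g H - (T - a • 1) * cfc g T := by
        rw [hSS, hPP, hTdef, add_sub_cancel_right]
    _ = _ := by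
        rw [hH.sub_smul_one_mul_cfc_slope, hT.sub_smul_one_mul_cfc_slope, sub_sub_sub_cancel_right]

open scoped Matrix.Norms.L2Operator in
/-- Loewner inequalities between values of the functional calculus pass to the limit. -/
theorem Matrix.cfc_le_cfc_of_continuous {f : ℝ → ℝ} {a b : ℝ} (hf : ContinuousOn f (Icc a b))
    {F G : ℝ → Matrix n n ℂ} (hF : Continuous F) (hG : Continuous G)
    (haF : ∀ t ∈ Icc (0 : ℝ) 1, a • (1 : Matrix n n ℂ) ≤ F t)
    (hFG : ∀ t ∈ Icc (0 : ℝ) 1, F t ≤ G t)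
    (hGb : ∀ t ∈ Icc (0 : ℝ) 1, G t ≤ b • (1 : Matrix n n ℂ))
    (h : ∀ t ∈ Ioc (0 : ℝ) 1, cfc f (F t) ≤ cfc f (G t)) :
    cfc f (F 0) ≤ cfc f (G 0) := by
  have key : ∀ {E : ℝ → Matrix n n ℂ}, Continuous E →
      (∀ t ∈ Icc (0 : ℝ) 1, a • (1 : Matrix n n ℂ) ≤ E t) →
      (∀ t ∈ Icc (0 : ℝ) 1, E t ≤ b • (1 : Matrix n n ℂ)) →
      Filter.Tendsto (fun t => cfc f (E t)) (𝓝[>] 0) (𝓝 (cfc f (E 0))) := by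
    intro E hE haE hEb
    have herm : ∀ t ∈ Icc (0 : ℝ) 1, (E t).IsHermitian := fun t ht =>
      isHermitian_of_smul_one_le (haE t ht)
    have hspec : ∀ t ∈ Icc (0 : ℝ) 1, spectrum ℝ (E t) ⊆ Icc a b := fun t ht x hx =>
      ⟨(herm t ht).smul_one_le_iff.1 (haE t ht) x hx,
        (herm t ht).le_smul_one_iff.1 (hEb t ht) x hx⟩
    have hev : ∀ᶠ t : ℝ in 𝓝[>] 0, t ∈ Icc (0 : ℝ) 1 :=
      Filter.mem_of_superset (Ioc_mem_nhdsGT one_pos) Ioc_subset_Icc_self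
    have h0 : (0 : ℝ) ∈ Icc (0 : ℝ) 1 := by simp
    exact Filter.Tendsto.cfc isCompact_Icc f (hE.continuousWithinAt)
      (hev.mono hspec) (hev.mono herm) (hspec 0 h0) (herm 0 h0) hf
  exact le_of_tendsto_of_tendsto
    (key hF haF fun t ht => (hFG t ht).trans (hGb t ht))
    (key hG (fun t ht => (haF t ht).trans (hFG t ht)) hGb)
    (Filter.mem_of_superset (Ioc_mem_nhdsGT one_pos) h)

theorem Matrix.cfc_submatrix_equiv (f : ℝ → ℝ) {M : Matrix n n ℂ} (hM : M.IsHermitian)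
    (e : m ≃ n) : cfc f (M.submatrix e e) = (cfc f M).submatrix e e := by
  set X : Matrix m n ℂ := (1 : Matrix n n ℂ).submatrix e id
  have hl : ∀ N : Matrix n n ℂ, X * N = N.submatrix e id := fun N => by
    ext i j; simp [X, mul_apply, one_apply]
  have hr : ∀ N : Matrix m m ℂ, N * X = N.submatrix id e.symm := fun N => by
    ext i j
    simp [X, mul_apply, one_apply, ← Equiv.eq_symm_apply]
  have h := cfc_mul_eq_mul_cfc f (hM.submatrix e) hM (X := X) (by rw [hl, hr]; ext; simp)
  rw [hl, hr] at h
  ext i j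
  simpa using congrFun (congrFun h i) (e j)

theorem Matrix.spectrum_submatrix_equiv (M : Matrix n n ℂ) (e : m ≃ n) :
    spectrum ℝ (M.submatrix e e) = spectrum ℝ M :=
  AlgEquiv.spectrum_eq (Matrix.reindexAlgEquiv ℝ ℂ e.symm) M

theorem Matrix.IsHermitian.forall_eigenvalues_mem_iff {M : Matrix n n ℂ} (hM : M.IsHermitian)
    {J : Set ℝ} : (∀ i, hM.eigenvalues i ∈ J) ↔ spectrum ℝ M ⊆ J := by
  rw [hM.spectrum_real_eq_range_eigenvalues, Set.range_subset_iff]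

/-- The inequality defining strong operator convexity holds for matrices over any index type. -/
theorem StronglyOperatorConvexOn.exists_forall_le {g : ℝ → ℝ} {J : Set ℝ}
    (hg : StronglyOperatorConvexOn g J) :
    ∃ x₀ ∈ J, ∀ {ι : Type} [Fintype ι] [DecidableEq ι] [Nonempty ι] (P H : Matrix ι ι ℂ),
      P.IsHermitian → P * P = P → H.IsHermitian → spectrum ℝ H ⊆ J →
      P * cfc g (P * H * P + x₀ • (1 - P)) * P ≤ cfc g H := by
  obtain ⟨x₀, hx₀, h⟩ := hg
  refine ⟨x₀, hx₀, fun {ι} _ _ _ P H hP hPP hH hHJ => ?_⟩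
  let e := (Fintype.equivFin ι).symm
  have hK := isHermitian_compress_add hP hH x₀
  have hKe : P.submatrix e e * H.submatrix e e * P.submatrix e e +
      (x₀ : ℂ) • (1 - P.submatrix e e) = (P * H * P + x₀ • (1 - P)).submatrix e e := by
    simp only [submatrix_mul_equiv]
    ext i j
    simp [one_apply]
  have hKe' := hK.submatrix e
  rw [← hKe] at hKe'
  have key := h (Fintype.card ι) Fintype.card_pos (P.submatrix e e) (H.submatrix e e)
    (hP.submatrix e) (by rw [submatrix_mul_equiv, hPP]) (hH.submatrix e) hKe'
    ((hH.submatrix e).forall_eigenvalues_mem_iff.2 (by rwa [spectrum_submatrix_equiv]))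
  rw [← IsHermitian.cfc_eq, ← IsHermitian.cfc_eq, hKe, cfc_submatrix_equiv g hH,
    cfc_submatrix_equiv g hK, submatrix_mul_equiv, submatrix_mul_equiv] at key
  have hkey := key.submatrix e.symm
  rwa [submatrix_sub, Pi.sub_apply, Pi.sub_apply, submatrix_submatrix, submatrix_submatrix,
    Equiv.self_comp_symm, submatrix_id_id, submatrix_id_id, ← le_iff] at hkey

theorem Matrix.PosSemidef.fromBlocks_zero {A : Matrix m m ℂ} {D : Matrix n n ℂ}
    (hA : A.PosSemidef) (hD : D.PosSemidef) : (fromBlocks A 0 0 D).PosSemidef := by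
  have h1 := hA.mul_mul_conjTranspose_same (fromRows (1 : Matrix m m ℂ) (0 : Matrix n m ℂ))
  have h2 := hD.mul_mul_conjTranspose_same (fromRows (0 : Matrix m n ℂ) (1 : Matrix n n ℂ))
  convert h1.add h2 using 1
  rw [conjTranspose_fromRows_eq_fromCols_conjTranspose,
    conjTranspose_fromRows_eq_fromCols_conjTranspose]
  ext (i | i) (j | j) <;> simp [fromRows_mul]

/-- The orthogonal projection dilating a contraction `0 ≤ C ≤ 1`. -/
theorem Matrix.exists_projection_dilation {C : Matrix n n ℂ} (h0 : 0 ≤ C) (h1 : C ≤ 1) :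
    ∃ P : Matrix (n ⊕ n) (n ⊕ n) ℂ, P.IsHermitian ∧ P * P = P ∧ P.toBlocks₁₁ = C := by
  have hC : C.IsHermitian := (nonneg_iff_posSemidef.1 h0).isHermitian
  have hC' : IsSelfAdjoint C := hC
  have hpos : ∀ x ∈ spectrum ℝ C, 0 ≤ x - x * x := fun x hx => by
    have hx0 : 0 ≤ x := hC.smul_one_le_iff.1 (by simpa using h0) x hx
    have hx1 : x ≤ 1 := hC.le_smul_one_iff.1 (by simpa using h1) x hx
    nlinarith
  set W := cfc (fun x : ℝ => √(x - x * x)) C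
  have hW : W.IsHermitian := isHermitian_cfc _ _
  have hWW : W * W = C - C * C := by
    rw [cfc_sqrt_mul_self hpos, cfc_sub (fun x : ℝ => x) (fun x => x * x) C,
      cfc_mul (fun x : ℝ => x) (fun x => x) C, cfc_id' ℝ C hC']
  have hCW : W * C = C * W := cfc_mul_eq_mul_cfc _ hC hC rfl
  refine ⟨fromBlocks C W W (1 - C), ?_, ?_, by simp⟩
  · exact IsHermitian.fromBlocks hC hW.eq (isHermitian_one.sub hC)
  · rw [fromBlocks_multiply, hWW]
    congr 1
    · abel
    · rw [mul_sub, hCW, mul_one]; abel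
    · rw [sub_mul, hCW, one_mul]; abel
    · simp only [mul_sub, sub_mul, mul_one, one_mul]; abel

/-- If every compression inequality for `x ↦ (f x - f a) / (x - a)` holds in twice the dimension,
then `f` is monotone on pairs `a ≤ A ≤ B` with `B - a` invertible. -/
theorem Matrix.cfc_le_cfc_of_slope_compress_le {f : ℝ → ℝ} {a b x₀ : ℝ}
    (hf : ContinuousOn f (Icc a b)) (hab : a < b)
    (h : ∀ P H : Matrix (n ⊕ n) (n ⊕ n) ℂ, P.IsHermitian → P * P = P → H.IsHermitian →
      spectrum ℝ H ⊆ Ioc a b →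
      P * cfc (fun x => (f x - f a) / (x - a)) (P * H * P + x₀ • (1 - P)) * P ≤
        cfc (fun x => (f x - f a) / (x - a)) H)
    {A B : Matrix n n ℂ} (haA : a • (1 : Matrix n n ℂ) ≤ A) (hAB : A ≤ B)
    (hBb : B ≤ b • (1 : Matrix n n ℂ)) (hu : IsUnit (B - a • (1 : Matrix n n ℂ))) :
    cfc f A ≤ cfc f B := by
  have hA := isHermitian_of_smul_one_le haA
  have hB := isHermitian_of_smul_one_le (haA.trans hAB)
  obtain ⟨R, hR, hRR⟩ := exists_isHermitian_mul_self_eq_sub (haA.trans hAB)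
  have hRu : IsUnit R := isUnit_of_mul_isUnit_left (hRR ▸ hu)
  have hRdet := (isUnit_iff_isUnit_det R).1 hRu
  set C := R⁻¹ * (A - a • 1) * R⁻¹ with hCdef
  have hconj : ∀ Y : Matrix n n ℂ, 0 ≤ Y → 0 ≤ R⁻¹ * Y * R⁻¹ := fun Y hY => by
    have := (nonneg_iff_posSemidef.1 hY).conjTranspose_mul_mul_same R⁻¹
    rw [conjTranspose_nonsing_inv, hR.eq] at this
    exact nonneg_iff_posSemidef.2 this
  have hC0 : 0 ≤ C := hconj _ (sub_nonneg.2 haA)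
  have hC1 : C ≤ 1 := by
    have e : R⁻¹ * (B - A) * R⁻¹ = 1 - C := by
      have : B - A = R * R - (A - a • 1) := by rw [hRR]; abel
      rw [this, mul_sub, sub_mul, ← mul_assoc, nonsing_inv_mul R hRdet, one_mul,
        mul_nonsing_inv R hRdet]
    exact sub_nonneg.1 (e ▸ hconj _ (sub_nonneg.2 hAB))
  have hRCR : R * C * R = A - a • 1 := by
    rw [hCdef, mul_assoc, mul_assoc, nonsing_inv_mul R hRdet, mul_one,
      mul_nonsing_inv_cancel_left R _ hRdet]
  obtain ⟨P, hP, hPP, hPC⟩ := exists_projection_dilation hC0 hC1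
  obtain ⟨s, hs0, hss⟩ : ∃ s : ℝ, 0 < s ∧ s * s = b - a :=
    ⟨√(b - a), Real.sqrt_pos.2 (sub_pos.2 hab), Real.mul_self_sqrt (sub_pos.2 hab).le⟩
  let S : ℝ → Matrix (n ⊕ n) (n ⊕ n) ℂ := fun t => fromBlocks R 0 0 ((t * s) • 1)
  have hScont : Continuous S :=
    continuous_const.matrix_fromBlocks continuous_const continuous_const
      ((continuous_id.mul continuous_const).smul continuous_const)
  have hS : ∀ t, (S t).IsHermitian := fun t =>
    IsHermitian.fromBlocks hR (by simp) (isHermitian_real_smul_one _)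
  have hSS : ∀ t, S t * S t + a • 1 = fromBlocks B 0 0 ((a + t * t * (b - a)) • 1) := fun t => by
    rw [← fromBlocks_one, fromBlocks_smul, fromBlocks_multiply, fromBlocks_add]
    congr 1
    · rw [zero_mul, add_zero, hRR, sub_add_cancel]
    · simp
    · simp
    · rw [zero_mul, zero_add, smul_mul_smul, mul_one, ← add_smul, ← hss]
      congr 1; ring
  have hSPS : S 0 * P * S 0 + a • 1 = fromBlocks A 0 0 (a • 1) := by
    rw [← fromBlocks_toBlocks P, hPC, ← fromBlocks_one, fromBlocks_smul]
    simp only [S, fromBlocks_multiply, fromBlocks_add]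
    congr 1 <;> simp [hRCR]
  have hpsd : ∀ t (Q : Matrix (n ⊕ n) (n ⊕ n) ℂ), 0 ≤ Q → 0 ≤ S t * Q * S t := fun t Q hQ => by
    have := (nonneg_iff_posSemidef.1 hQ).conjTranspose_mul_mul_same (S t)
    rw [(hS t).eq] at this
    exact nonneg_iff_posSemidef.2 this
  have hproj : ∀ Q : Matrix (n ⊕ n) (n ⊕ n) ℂ, Q.IsHermitian → Q * Q = Q → 0 ≤ Q :=
    fun Q hQ hQQ => by
      have := posSemidef_conjTranspose_mul_self Q
      rw [hQ.eq, hQQ] at this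
      exact nonneg_iff_posSemidef.2 this
  have haF : ∀ t, a • (1 : Matrix (n ⊕ n) (n ⊕ n) ℂ) ≤ S t * P * S t + a • 1 := fun t =>
    le_add_of_nonneg_left (hpsd t P (hproj P hP hPP))
  have hFG : ∀ t, S t * P * S t + a • 1 ≤ S t * S t + a • 1 := fun t => by
    have := hpsd t (1 - P) (hproj _ (isHermitian_one.sub hP) (by simp [sub_mul, mul_sub, hPP]))
    rw [mul_sub, sub_mul, mul_one] at this
    exact add_le_add_left (sub_nonneg.1 this) _
  have hGb : ∀ t ∈ Icc (0 : ℝ) 1, S t * S t + a • 1 ≤ b • 1 := fun t ht => by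
    have ht' : 0 ≤ b - (a + t * t * (b - a)) := by
      have : t * t ≤ 1 := mul_le_one₀ ht.2 ht.1 ht.2
      nlinarith
    rw [hSS, le_iff, ← fromBlocks_one, fromBlocks_smul, sub_eq_add_neg, fromBlocks_neg,
      fromBlocks_add]
    simpa only [sub_eq_add_neg, add_smul, neg_smul, smul_zero, neg_zero, add_zero] using (le_iff.1 hBb).fromBlocks_zero (PosSemidef.one.smul ht')
  have key : cfc f (S 0 * P * S 0 + a • 1) ≤ cfc f (S 0 * S 0 + a • 1) := by
    refine cfc_le_cfc_of_continuous (F := fun t => S t * P * S t + a • 1)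
      (G := fun t => S t * S t + a • 1) hf (by fun_prop) (by fun_prop)
      (fun t _ => haF t) (fun t _ => hFG t) hGb fun t ht => ?_
    have haG := (haF t).trans (hFG t)
    have hG := isHermitian_of_smul_one_le haG
    have hSu : IsUnit (S t) := by
      have hts : t * s ≠ 0 := (mul_pos ht.1 hs0).ne'
      refine IsUnit.of_mul_eq_one (fromBlocks R⁻¹ 0 0 ((t * s)⁻¹ • 1)) ?_
      rw [fromBlocks_multiply, ← fromBlocks_one]
      congr 1
      · simp [mul_nonsing_inv R hRdet]
      · simp
      · simp
      · rw [zero_mul, zero_add, smul_mul_smul, mul_one, mul_inv_cancel₀ hts, one_smul]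
    have hsp : spectrum ℝ (S t * S t + a • 1) ⊆ Ioc a b := fun x hx => by
      refine ⟨lt_of_le_of_ne (hG.smul_one_le_iff.1 haG x hx) ?_,
        hG.le_smul_one_iff.1 (hGb t ⟨ht.1.le, ht.2⟩) x hx⟩
      rintro rfl
      rw [spectrum.mem_iff, Algebra.algebraMap_eq_smul_one, sub_add_cancel_right] at hx
      exact hx (hSu.mul hSu).neg
    have hdef := h P _ hP hPP hG hsp
    have := (le_iff.1 hdef).conjTranspose_mul_mul_same (S t)
    rwa [(hS t).eq, mul_slope_defect_mul hP hPP hG (hS t) (add_sub_cancel_right _ _).symm,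
      ← le_iff] at this
  rw [hSPS, hSS] at key
  let J : Matrix (n ⊕ n) n ℂ := fromRows 1 0
  have hblock : ∀ {M : Matrix n n ℂ} (c : ℝ), M.IsHermitian →
      Jᴴ * cfc f (fromBlocks M 0 0 (c • (1 : Matrix n n ℂ))) * J = cfc f M := fun {M} c hM => by
    have hJ : fromBlocks M 0 0 (c • (1 : Matrix n n ℂ)) * J = J * M := by
      ext i j
      rcases i with i | i <;> simp [J, mul_apply, fromBlocks, one_apply]
    have hJJ : Jᴴ * J = 1 := by
      simp [J, conjTranspose_fromRows_eq_fromCols_conjTranspose, fromCols_mul_fromRows]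
    rw [Matrix.mul_assoc, cfc_mul_eq_mul_cfc f
      (IsHermitian.fromBlocks hM (by simp) (isHermitian_real_smul_one c)) hM hJ,
      ← Matrix.mul_assoc, hJJ, Matrix.one_mul]
  have := (le_iff.1 key).conjTranspose_mul_mul_same J
  rwa [Matrix.mul_sub, Matrix.sub_mul, hblock _ hA, hblock _ hB, ← le_iff] at this

theorem Matrix.exists_mem_le_smul_one [Nonempty n] {M : Matrix n n ℂ} (hM : M.IsHermitian)
    {J : Set ℝ} (hJ : spectrum ℝ M ⊆ J) : ∃ b ∈ J, M ≤ b • (1 : Matrix n n ℂ) := by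
  have hne : (spectrum ℝ M).Nonempty :=
    hM.spectrum_real_eq_range_eigenvalues ▸ Set.range_nonempty _
  obtain ⟨b, hb, hmax⟩ := Set.exists_max_image _ id M.finite_real_spectrum hne
  exact ⟨b, hJ hb, hM.le_smul_one_iff.2 hmax⟩

end FunctionalCalculus

/-- Divided differences of operator monotone functions are strongly operator convex. -/
theorem OperatorMonotoneOn.stronglyOperatorConvexOn_slope {I : Set ℝ} (hI : Convex ℝ I)
    (hnt : I.Nontrivial) {a : ℝ} (ha : a ∈ I) (hleft : ∀ x ∈ I, a ≤ x) {f : ℝ → ℝ}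
    (hf : OperatorMonotoneOn f I) :
    StronglyOperatorConvexOn (fun x => (f x - f a) / (x - a)) (I \ {a}) := by
  obtain ⟨x₀, hx₀, hx₀a⟩ := hnt.exists_ne a
  refine ⟨x₀, ⟨hx₀, hx₀a⟩, fun n hn P H hP hPP hH hK hsp => ?_⟩
  have : Nonempty (Fin n) := ⟨⟨0, hn⟩⟩
  rw [hH.forall_eigenvalues_mem_iff] at hsp
  obtain ⟨b, hb, hHb⟩ := exists_mem_le_smul_one hH (hsp.trans Set.sdiff_subset)
  have haH : a • (1 : Matrix (Fin n) (Fin n) ℂ) ≤ H :=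
    hH.smul_one_le_iff.2 fun x hx => hleft x (hsp hx).1
  obtain ⟨S, hS, hSS⟩ := exists_isHermitian_mul_self_eq_sub haH
  have hu : IsUnit (S * S) := by
    have : a ∉ spectrum ℝ H := fun h => (hsp h).2 rfl
    rw [spectrum.notMem_iff, Algebra.algebraMap_eq_smul_one] at this
    simpa [hSS] using this.neg
  have hSu : IsUnit S := isUnit_of_mul_isUnit_left hu
  have hproj : ∀ Q : Matrix (Fin n) (Fin n) ℂ, Q.IsHermitian → Q * Q = Q → 0 ≤ S * Q * S :=
    fun Q hQ hQQ => by
      have := posSemidef_conjTranspose_mul_self (Q * S)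
      rw [conjTranspose_mul, hS.eq, hQ.eq, mul_assoc, ← mul_assoc Q Q, hQQ, ← mul_assoc] at this
      exact nonneg_iff_posSemidef.2 this
  have haT : a • (1 : Matrix (Fin n) (Fin n) ℂ) ≤ S * P * S + a • 1 :=
    le_add_of_nonneg_left (hproj P hP hPP)
  have hTH : S * P * S + a • 1 ≤ H := by
    have := hproj (1 - P) (isHermitian_one.sub hP) (by simp [sub_mul, mul_sub, hPP])
    rw [mul_sub, sub_mul, mul_one, hSS] at this
    rw [← sub_nonneg]
    convert this using 1
    abel
  have hT := isHermitian_of_smul_one_le haT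
  have hmono := hf n hn _ H hT hH (hT.forall_eigenvalues_mem_iff.2 fun x hx =>
      hI.ordConnected.out ha hb ⟨hT.smul_one_le_iff.1 haT x hx,
        hT.le_smul_one_iff.1 (hTH.trans hHb) x hx⟩)
    (hH.forall_eigenvalues_mem_iff.2 (hsp.trans Set.sdiff_subset)) hTH
  rw [← hT.cfc_eq, ← hH.cfc_eq, ← mul_slope_defect_mul hP hPP hH hS hSS x₀ f] at hmono
  rw [← hH.cfc_eq, ← hK.cfc_eq, ← hSu.posSemidef_star_left_conjugate_iff, star_eq_conjTranspose,
    hS.eq]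
  exact hmono

/-- A continuous function with strongly operator convex divided difference at the left endpoint
is operator monotone. -/
theorem StronglyOperatorConvexOn.operatorMonotoneOn_of_slope {I : Set ℝ} (hI : Convex ℝ I)
    {a : ℝ} (ha : a ∈ I) (hleft : ∀ x ∈ I, a ≤ x) {f : ℝ → ℝ} (hf : ContinuousOn f I)
    (hg : StronglyOperatorConvexOn (fun x => (f x - f a) / (x - a)) (I \ {a})) :
    OperatorMonotoneOn f I := by
  obtain ⟨x₀, hx₀, h⟩ := hg.exists_forall_le
  intro n hn A B hA hB hAI hBI hAB
  have : Nonempty (Fin n) := ⟨⟨0, hn⟩⟩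
  rw [hA.forall_eigenvalues_mem_iff] at hAI
  rw [hB.forall_eigenvalues_mem_iff] at hBI
  rw [← hA.cfc_eq, ← hB.cfc_eq, ← le_iff]
  rw [← le_iff] at hAB
  obtain ⟨b₁, hb₁, hBb₁⟩ := exists_mem_le_smul_one hB hBI
  obtain ⟨b, hb, hab, hBb⟩ : ∃ b ∈ I, a < b ∧ B ≤ b • (1 : Matrix (Fin n) (Fin n) ℂ) := by
    refine ⟨max b₁ x₀, by rcases max_choice b₁ x₀ with h | h <;> simp [h, hb₁, hx₀.1],
      lt_max_of_lt_right (lt_of_le_of_ne (hleft _ hx₀.1) (Ne.symm hx₀.2)),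
      hB.le_smul_one_iff.2 fun x hx => (hB.le_smul_one_iff.1 hBb₁ x hx).trans (le_max_left _ _)⟩
  have hIcc : Icc a b ⊆ I := hI.ordConnected.out ha hb
  have haA : a • (1 : Matrix (Fin n) (Fin n) ℂ) ≤ A :=
    hA.smul_one_le_iff.2 fun x hx => hleft x (hAI hx)
  let D : ℝ → Matrix (Fin n) (Fin n) ℂ → Matrix (Fin n) (Fin n) ℂ :=
    fun t M => (1 - t) • M + (t * b) • 1
  have hDa : ∀ t ∈ Icc (0 : ℝ) 1, ∀ M, a • (1 : Matrix (Fin n) (Fin n) ℂ) ≤ M →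
      (a + t * (b - a)) • (1 : Matrix (Fin n) (Fin n) ℂ) ≤ D t M := fun t ht M hM => by
    have e : a + t * (b - a) = (1 - t) * a + t * b := by ring
    rw [e, add_smul, mul_smul]
    exact add_le_add_left (smul_le_smul_of_nonneg_left hM (sub_nonneg.2 ht.2)) _
  have hDle : ∀ t ∈ Icc (0 : ℝ) 1, D t A ≤ D t B := fun t ht =>
    add_le_add_left (smul_le_smul_of_nonneg_left hAB (sub_nonneg.2 ht.2)) _
  have hDb : ∀ t ∈ Icc (0 : ℝ) 1, D t B ≤ b • (1 : Matrix (Fin n) (Fin n) ℂ) := fun t ht => by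
    have e : b = (1 - t) * b + t * b := by ring
    conv_rhs => rw [e, add_smul, mul_smul]
    exact add_le_add_left (smul_le_smul_of_nonneg_left hBb (sub_nonneg.2 ht.2)) _
  have hDa' : ∀ t ∈ Icc (0 : ℝ) 1, a • (1 : Matrix (Fin n) (Fin n) ℂ) ≤ D t A := fun t ht =>
    (smul_le_smul_of_nonneg_right (le_add_of_nonneg_right (mul_nonneg ht.1 (sub_nonneg.2 hab.le)))
      (nonneg_iff_posSemidef.2 PosSemidef.one)).trans (hDa t ht A haA)
  have key : cfc f (D 0 A) ≤ cfc f (D 0 B) := by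
    refine cfc_le_cfc_of_continuous (F := fun t => D t A) (G := fun t => D t B) (hf.mono hIcc)
      (by fun_prop) (by fun_prop) hDa' hDle hDb fun t ht => ?_
    have ht' : t ∈ Icc (0 : ℝ) 1 := ⟨ht.1.le, ht.2⟩
    have haB := (hDa' t ht').trans (hDle t ht')
    refine cfc_le_cfc_of_slope_compress_le (hf.mono hIcc) hab
      (fun P H hP hPP hH hsp => h P H hP hPP hH (hsp.trans fun x hx =>
        ⟨hIcc (Ioc_subset_Icc_self hx), hx.1.ne'⟩)) (hDa' t ht') (hDle t ht') (hDb t ht') ?_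
    have hnot : a ∉ spectrum ℝ (D t B) := fun hmem => by
      have := (isHermitian_of_smul_one_le haB).smul_one_le_iff.1 (hDa t ht' B (haA.trans hAB))
        a hmem
      nlinarith [mul_pos ht.1 (sub_pos.2 hab)]
    rw [spectrum.notMem_iff, Algebra.algebraMap_eq_smul_one] at hnot
    simpa using hnot.neg
  simpa [D] using key

/-- for a nondegenerate interval `I` containing its left endpoint `a` and a
continuous `f : I → ℝ`, `f` is operator monotone on `I` iff
`g(x) = (f(x) − f(a))/(x − a)` is strongly operator convex on `I \ {a}`. -/
theorem stmt0 (I : Set ℝ) (hI : Convex ℝ I) (hnt : I.Nontrivial)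
    (a : ℝ) (ha : a ∈ I) (hleft : ∀ x ∈ I, a ≤ x)
    (f : ℝ → ℝ) (hf : ContinuousOn f I) :
    OperatorMonotoneOn f I ↔
      StronglyOperatorConvexOn (fun x => (f x - f a) / (x - a)) (I \ {a}) :=
  ⟨fun h => h.stronglyOperatorConvexOn_slope hI hnt ha hleft,
    fun h => h.operatorMonotoneOn_of_slope hI ha hleft hf⟩
end

section
/- Let I ⊆ ℝ be an open interval, let f be operator monotone on I, and let x₀ ∈ I. Then f is differentiable at x₀, and the function g defined on I by g(x) = (f(x) − f(x₀))/(x − x₀) for x ≠ x₀ and g(x₀) = f′(x₀) is strongly operator convex on I. -/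
open Matrix Set
open scoped ComplexOrder

theorem OperatorMonotoneOn.posSemidef_cfc_sub {f : ℝ → ℝ} {I : Set ℝ}
    (hf : OperatorMonotoneOn f I) {n : ℕ} (hn : 0 < n) {A B : Matrix (Fin n) (Fin n) ℂ}
    (hA : A.IsHermitian) (hB : B.IsHermitian) (hAI : spectrum ℝ A ⊆ I) (hBI : spectrum ℝ B ⊆ I)
    (hAB : (B - A).PosSemidef) : (cfc f B - cfc f A).PosSemidef := by
  rw [hA.cfc_eq, hB.cfc_eq]
  exact hf n hn A B hA hB (fun i => hAI (hA.eigenvalues_mem_spectrum_real i))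
    (fun i => hBI (hB.eigenvalues_mem_spectrum_real i)) hAB

theorem Matrix.continuousOn_spectrum {n : ℕ} (A : Matrix (Fin n) (Fin n) ℂ) (f : ℝ → ℝ) :
    ContinuousOn f (spectrum ℝ A) :=
  Matrix.finite_real_spectrum.continuousOn f

section
open scoped Matrix.Norms.L2Operator Topology
open Filter

theorem Matrix.eventually_spectrum_subset_and_tendsto_cfc {n : ℕ} {I : Set ℝ} (hI : IsOpen I)
    {B : ℝ → Matrix (Fin n) (Fin n) ℂ} (hB : Continuous B) (hBh : ∀ e, (B e).IsHermitian)
    (h0 : spectrum ℝ (B 0) ⊆ I) :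
    (∀ᶠ e in 𝓝 0, spectrum ℝ (B e) ⊆ I) ∧
      ∀ h : ℝ → ℝ, ContinuousOn h I →
        Tendsto (fun e => cfc h (B e)) (𝓝 0) (𝓝 (cfc h (B 0))) := by
  obtain ⟨K, hK, h0K, hKI⟩ :=
    exists_compact_between (ContinuousFunctionalCalculus.isCompact_spectrum (R := ℝ) (B 0)) hI h0
  have hev : ∀ᶠ e in 𝓝 0, spectrum ℝ (B e) ⊆ K := by
    have ho := (upperHemicontinuous_spectrum ℝ (Matrix (Fin n) (Fin n) ℂ)).isOpen K
    have hmem : {x : Matrix (Fin n) (Fin n) ℂ | K ∈ 𝓝ˢ (spectrum ℝ x)} ∈ 𝓝 (B 0) :=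
      ho.mem_nhds (mem_nhdsSet_iff_exists.2 ⟨interior K, isOpen_interior, h0K, interior_subset⟩)
    filter_upwards [hB.continuousAt.preimage_mem_nhds hmem] with e he
    exact subset_of_mem_nhdsSet he
  refine ⟨hev.mono fun e he => he.trans hKI, fun h hh => ?_⟩
  exact (hB.tendsto 0).cfc hK h hev (Eventually.of_forall hBh) (h0K.trans interior_subset) (hBh 0)
    (hh.mono hKI)

end

theorem Matrix.IsHermitian.cfc_eq_add_dslope {n : ℕ} {B : Matrix (Fin n) (Fin n) ℂ}
    (hB : B.IsHermitian) (f : ℝ → ℝ) (a : ℝ) :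
    cfc f B = (f a : ℂ) • (1 : Matrix (Fin n) (Fin n) ℂ)
      + (B - (a : ℂ) • (1 : Matrix (Fin n) (Fin n) ℂ)) * cfc (dslope f a) B := by
  have hB' : IsSelfAdjoint B := hB
  have c := Matrix.continuousOn_spectrum B
  have h1 : f = fun x => f a + (x - a) * dslope f a x := by
    ext x
    have := sub_smul_dslope f a x
    simp only [smul_eq_mul] at this
    linarith
  have h2 : (B - (a : ℂ) • (1 : Matrix (Fin n) (Fin n) ℂ)) = cfc (fun x : ℝ => x - a) B := by
    rw [cfc_sub _ _ B (c _) (c _), cfc_id' ℝ B hB', cfc_const a B hB']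
    congr 1
    ext i j
    simp [Matrix.algebraMap_matrix_apply, Matrix.one_apply]
  rw [h2, ← cfc_mul _ _ B (c _) (c _)]
  conv_lhs => rw [h1]
  rw [cfc_add _ _ _ (c _) (c _), cfc_const _ B hB']
  congr 1
  ext i j
  simp [Matrix.algebraMap_matrix_apply, Matrix.one_apply]

theorem Matrix.cfc_diagonal_apply {n : ℕ} (d : Fin n → ℝ) (f : ℝ → ℝ) (i j : Fin n) :
    cfc f (diagonal fun i => (d i : ℂ)) i j = if i = j then (f (d i) : ℂ) else 0 := by
  have hA : (diagonal fun i => (d i : ℂ)).IsHermitian := by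
    rw [Matrix.isHermitian_diagonal_iff]; intro i; simp [isSelfAdjoint_iff]
  rw [hA.cfc_eq_add_dslope f (d i)]
  have : (diagonal fun i => (d i : ℂ)) - (d i : ℂ) • (1 : Matrix (Fin n) (Fin n) ℂ)
      = diagonal fun k => (d k : ℂ) - d i := by
    rw [smul_one_eq_diagonal, diagonal_sub]
  rw [this, add_apply, diagonal_mul]
  simp [Matrix.one_apply]

theorem Matrix.spectrum_diagonal_ofReal {n : ℕ} (d : Fin n → ℝ) :
    spectrum ℝ (diagonal fun i => (d i : ℂ)) ⊆ range d := by
  intro x hx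
  rw [← spectrum.preimage_algebraMap ℂ, mem_preimage, _root_.spectrum_diagonal] at hx
  obtain ⟨i, hi⟩ := hx
  exact ⟨i, by simpa using hi⟩

theorem Matrix.cfc_sub_cfc_diagonal_apply {n : ℕ} {B : Matrix (Fin n) (Fin n) ℂ}
    (hB : B.IsHermitian) (d : Fin n → ℝ) (f : ℝ → ℝ) (i j : Fin n) :
    (cfc f B - cfc f (diagonal fun i => (d i : ℂ))) i j =
      ((B - diagonal fun i => (d i : ℂ)) * cfc (dslope f (d i)) B) i j := by
  rw [sub_apply, cfc_diagonal_apply, hB.cfc_eq_add_dslope f (d i), sub_mul, sub_mul, add_apply,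
    sub_apply, sub_apply, diagonal_mul, smul_mul_assoc, one_mul]
  simp [Matrix.one_apply]

theorem OperatorMonotoneOn.re_sum_dslope_nonneg {f : ℝ → ℝ} {I : Set ℝ}
    (hf : OperatorMonotoneOn f I) (hI : IsOpen I) (hd : ∀ x ∈ I, DifferentiableAt ℝ f x)
    {x₀ c : ℝ} (hx₀ : x₀ ∈ I) (hc : c ∈ I) (hne : c ≠ x₀) {m : ℕ} {a : Fin m → ℝ}
    (ha : ∀ i, a i ∈ I) (hane : ∀ i, a i ≠ x₀) (z : Fin m → ℂ) :
    0 ≤ (∑ i, ∑ j, star (z i) * z j *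
      ((dslope f (a i) (a j) + (x₀ - c) * dslope (dslope f (a i)) x₀ (a j) : ℝ) : ℂ)).re := by
  obtain ⟨σ, s, hσ, hs⟩ : ∃ σ s : ℝ, (σ = 1 ∨ σ = -1) ∧ σ * s ^ 2 = x₀ - c := by
    rcases hne.lt_or_gt with h | h
    · exact ⟨1, √(x₀ - c), Or.inl rfl, by rw [Real.sq_sqrt (by linarith)]; ring⟩
    · exact ⟨-1, √(c - x₀), Or.inr rfl, by rw [Real.sq_sqrt (by linarith)]; ring⟩
  have hs' : (σ : ℂ) * (s : ℂ) ^ 2 = x₀ - c := by exact_mod_cast hs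
  let d : Fin (m + 1) → ℝ := Fin.cons c a
  let d₀ : Fin (m + 1) → ℝ := Fin.cons x₀ a
  let D : Matrix (Fin (m + 1)) (Fin (m + 1)) ℂ := diagonal fun i => (d i : ℂ)
  let t : ℝ → Fin (m + 1) → ℝ := fun e => Fin.cons s fun _ => e
  let V : ℝ → Matrix (Fin (m + 1)) (Fin (m + 1)) ℂ := fun e =>
    vecMulVec (fun i => (t e i : ℂ)) (fun i => (t e i : ℂ))
  let B : ℝ → Matrix (Fin (m + 1)) (Fin (m + 1)) ℂ := fun e => D + (σ : ℂ) • V e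
  have hVpos : ∀ e, (V e).PosSemidef := fun e => by
    have := posSemidef_vecMulVec_self_star (fun i => (t e i : ℂ))
    have hstar : star (fun i => (t e i : ℂ)) = fun i => (t e i : ℂ) := by
      funext i
      simp
    rwa [hstar] at this
  have hD : D.IsHermitian := by
    rw [Matrix.isHermitian_diagonal_iff]; intro i; simp [isSelfAdjoint_iff]
  have hB : ∀ e, (B e).IsHermitian := fun e => by
    refine hD.add ?_
    have := (hVpos e).isHermitian
    rw [IsHermitian, conjTranspose_smul, this.eq]
    simp
  have hBc : Continuous B := by
    suffices hVc : Continuous V from continuous_const.add (hVc.const_smul (σ : ℂ))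
    refine continuous_matrix fun i j => ?_
    refine Fin.cases ?_ (fun i => ?_) i <;> refine Fin.cases ?_ (fun j => ?_) j <;>
      simp only [V, t, vecMulVec_apply, Fin.cons_zero, Fin.cons_succ] <;> fun_prop
  have hB0 : B 0 = diagonal fun i => (d₀ i : ℂ) := by
    ext i j
    refine Fin.cases ?_ (fun i => ?_) i <;> refine Fin.cases ?_ (fun j => ?_) j
    · simp only [B, D, V, t, d, d₀, Matrix.add_apply, Matrix.smul_apply,
          vecMulVec_apply, Fin.cons_zero,
        diagonal_apply_eq, smul_eq_mul]
      linear_combination hs'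
    all_goals simp [B, D, V, t, d, d₀, vecMulVec_apply, diagonal_apply, (Fin.succ_ne_zero _).symm]
  have hDI : spectrum ℝ D ⊆ I := (spectrum_diagonal_ofReal d).trans <| by
    rintro _ ⟨i, rfl⟩
    exact Fin.cases hc ha i
  have hB0I : spectrum ℝ (B 0) ⊆ I := by
    rw [hB0]
    refine (spectrum_diagonal_ofReal d₀).trans ?_
    rintro _ ⟨i, rfl⟩
    exact Fin.cases hx₀ ha i
  obtain ⟨hspec, hlim⟩ := eventually_spectrum_subset_and_tendsto_cfc hI hBc hB hB0I
  have hfc : ContinuousOn f I := fun x hx => (hd x hx).continuousAt.continuousWithinAt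
  have hc1 : ∀ i, ContinuousOn (dslope f (a i)) I := fun i =>
    (continuousOn_dslope (hI.mem_nhds (ha i))).2 ⟨hfc, hd _ (ha i)⟩
  have hc2 : ∀ i, ContinuousOn (dslope (dslope f (a i)) x₀) I := fun i =>
    (continuousOn_dslope (hI.mem_nhds hx₀)).2
      ⟨hc1 i, (differentiableAt_dslope_of_ne (hane i).symm).2 (hd _ hx₀)⟩
  let G : ℝ → Fin m → Matrix (Fin (m + 1)) (Fin (m + 1)) ℂ := fun e i =>
    cfc (dslope f (a i)) (B e) + ((x₀ - c : ℝ) : ℂ) • cfc (dslope (dslope f (a i)) x₀) (B e)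
  have hGlim : ∀ i, Filter.Tendsto (fun e => G e i) (nhds 0) (nhds (G 0 i)) := fun i =>
    (hlim _ (hc1 i)).add ((hlim _ (hc2 i)).const_smul _)
  have hG0 : ∀ i j, ∑ l : Fin m, G 0 i l.succ j.succ =
      ((dslope f (a i) (a j) + (x₀ - c) * dslope (dslope f (a i)) x₀ (a j) : ℝ) : ℂ) := by
    intro i j
    simp only [G, hB0, Matrix.add_apply, Matrix.smul_apply, cfc_diagonal_apply, Fin.succ_inj,
      smul_eq_mul]
    rw [Finset.sum_eq_single j]
    · simp [d₀]
    · intro l _ hl; simp [hl]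
    · simp
  have hentry : ∀ e i j, (cfc f (B e) - cfc f D) (Fin.succ i) (Fin.succ j) =
      σ * e ^ 2 * ∑ l : Fin m, G e i l.succ j.succ := by
    intro e i j
    have h1 : B e - D = (σ : ℂ) • V e := by simp [B]
    have h2 : cfc (dslope f (a i)) (B e) 0 (Fin.succ j) =
        σ * s * e * ∑ l : Fin m, cfc (dslope (dslope f (a i)) x₀) (B e) l.succ j.succ := by
      rw [(hB e).cfc_eq_add_dslope _ x₀, Matrix.add_apply, mul_apply, Fin.sum_univ_succ]
      have h00 : (B e - (x₀ : ℂ) • (1 : Matrix (Fin (m + 1)) (Fin (m + 1)) ℂ)) 0 0 = 0 := by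
        simp only [B, D, V, t, d, Matrix.add_apply, Matrix.sub_apply, Matrix.smul_apply,
          vecMulVec_apply, Fin.cons_zero,
          diagonal_apply_eq, smul_eq_mul, one_apply_eq]
        linear_combination hs'
      have h0l : ∀ l : Fin m, (B e - (x₀ : ℂ) • (1 : Matrix (Fin (m + 1)) (Fin (m + 1)) ℂ)) 0
          l.succ = σ * s * e := by
        intro l
        simp [B, D, V, t, vecMulVec_apply, one_apply, (Fin.succ_ne_zero l).symm]
        ring
      simp only [h00, h0l]
      simp [one_apply, (Fin.succ_ne_zero j).symm, Finset.mul_sum]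
    have h3 : (cfc f (B e) - cfc f D) (Fin.succ i) (Fin.succ j) =
        ((B e - D) * cfc (dslope f (a i)) (B e)) (Fin.succ i) (Fin.succ j) :=
      cfc_sub_cfc_diagonal_apply (hB e) d f (Fin.succ i) (Fin.succ j)
    rw [h3, h1, smul_mul_assoc, Matrix.smul_apply, mul_apply, Fin.sum_univ_succ]
    simp only [V, t, vecMulVec_apply, Fin.cons_zero, Fin.cons_succ, h2, G, Matrix.add_apply,
      Matrix.smul_apply,
      smul_eq_mul, Finset.sum_add_distrib, ← Finset.mul_sum]
    push_cast
    linear_combination (σ : ℂ) * e ^ 2 *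
      (∑ l : Fin m, cfc (dslope (dslope f (a i)) x₀) (B e) l.succ j.succ) * hs'
  have hpos : ∀ e, spectrum ℝ (B e) ⊆ I → ((σ : ℂ) • (cfc f (B e) - cfc f D)).PosSemidef := by
    intro e he
    rcases hσ with rfl | rfl
    · simpa using hf.posSemidef_cfc_sub m.succ_pos hD (hB e) hDI he (by simpa [B] using hVpos e)
    · simpa using hf.posSemidef_cfc_sub m.succ_pos (hB e) hD he hDI (by simpa [B] using hVpos e)
  have hev : ∀ᶠ e in nhdsWithin (0 : ℝ) {0}ᶜ,
      0 ≤ (∑ i, ∑ j, star (z i) * z j * ∑ l : Fin m, G e i l.succ j.succ).re := by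
    filter_upwards [nhdsWithin_le_nhds hspec, self_mem_nhdsWithin] with e he he0
    have h := (hpos e he).dotProduct_mulVec_nonneg (Fin.cons 0 z)
    have h' : star (Fin.cons 0 z : Fin (m + 1) → ℂ) ⬝ᵥ
        (((σ : ℂ) • (cfc f (B e) - cfc f D)) *ᵥ (Fin.cons 0 z)) =
        ((e ^ 2 : ℝ) : ℂ) *
          ∑ i, ∑ j, star (z i) * z j * ∑ l : Fin m, G e i l.succ j.succ := by
      have hσ2 : (σ : ℂ) * σ = 1 := by rcases hσ with rfl | rfl <;> simp
      simp only [dotProduct, mulVec, Fin.sum_univ_succ (n := m), Pi.star_apply, Fin.cons_zero,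
        Fin.cons_succ, star_zero, zero_mul, zero_add, mul_zero, Matrix.smul_apply, hentry,
        smul_eq_mul]
      rw [Finset.mul_sum]
      refine Finset.sum_congr rfl fun i _ => ?_
      rw [Finset.mul_sum, Finset.mul_sum]
      refine Finset.sum_congr rfl fun j _ => ?_
      push_cast
      linear_combination (star (z i) * e ^ 2 * (∑ l : Fin m, G e i l.succ j.succ) * z j) * hσ2
    rw [h'] at h
    have h2 := (Complex.le_def.1 h).1
    rw [Complex.re_ofReal_mul, Complex.zero_re] at h2
    exact (mul_nonneg_iff_of_pos_left (sq_pos_of_ne_zero he0)).1 h2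
  have hlim' : Filter.Tendsto
      (fun e => (∑ i, ∑ j, star (z i) * z j * ∑ l : Fin m, G e i l.succ j.succ).re)
      (nhdsWithin (0 : ℝ) {0}ᶜ)
      (nhds (∑ i, ∑ j, star (z i) * z j * ∑ l : Fin m, G 0 i l.succ j.succ).re) := by
    refine (Complex.continuous_re.tendsto _).comp ?_
    refine tendsto_finsetSum _ fun i _ => tendsto_finsetSum _ fun j _ =>
      Filter.Tendsto.const_mul _ (tendsto_finsetSum _ fun l _ => ?_)
    exact (((continuous_apply_apply l.succ j.succ).tendsto _).comp (hGlim i)).mono_left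
      nhdsWithin_le_nhds
  have := ge_of_tendsto hlim' hev
  simpa only [hG0] using this

theorem dslope_add_mul_dslope_dslope (f : ℝ → ℝ) {x₀ y w : ℝ} (hy : y ≠ x₀) (c : ℝ) :
    dslope f y w + (x₀ - c) * dslope (dslope f y) x₀ w =
      dslope f x₀ y + (w - c) * dslope (dslope f y) x₀ w := by
  have h1 := sub_smul_dslope (dslope f y) x₀ w
  rw [dslope_of_ne f hy.symm, slope_comm, ← dslope_of_ne f hy, smul_eq_mul] at h1
  linear_combination -h1

theorem dslope_add_mul_dslope_dslope_self (f : ℝ → ℝ) {x₀ y w : ℝ} (hy : y ≠ x₀) (hw : w ≠ x₀) :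
    dslope f x₀ y + (w - y) * dslope (dslope f y) x₀ w = dslope f x₀ w := by
  have h1 := sub_smul_dslope (dslope f y) x₀ w
  rw [dslope_of_ne f hy.symm, slope_comm, ← dslope_of_ne f hy, smul_eq_mul] at h1
  have h2 := sub_smul_dslope f y w
  have h3 := sub_smul_dslope f x₀ w
  have h4 := sub_smul_dslope f x₀ y
  simp only [smul_eq_mul] at h2 h3 h4
  apply mul_left_cancel₀ (sub_ne_zero.2 hw)
  linear_combination (w - y) * h1 + h2 - h3 + h4

theorem OperatorMonotoneOn.re_sum_dslope_sub_nonneg_of_ne {f : ℝ → ℝ} {I : Set ℝ}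
    (hf : OperatorMonotoneOn f I) (hI : IsOpen I) (hd : ∀ x ∈ I, DifferentiableAt ℝ f x)
    {x₀ : ℝ} (hx₀ : x₀ ∈ I) {n : ℕ} {l μ : Fin n → ℝ} (hl : ∀ i, l i ∈ I) (hl' : ∀ i, l i ≠ x₀)
    (hμ : ∀ i, μ i ∈ I) (hμ' : ∀ i, μ i ≠ x₀) (ψ : Fin n → ℂ) (x : Fin n → Fin n → ℂ)
    (h1 : ∀ j k, ∑ i, (l i : ℂ) * (star (x i j) * x i k) = μ k * ∑ i, star (x i j) * x i k)
    (h2 : ∀ j, ∑ i, star (ψ i) * x i j = ∑ k, ∑ i, star (x i k) * x i j) :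
    0 ≤ (∑ i, ((dslope f x₀ (l i) : ℝ) : ℂ) * (star (ψ i) * ψ i) -
      ∑ j, ((dslope f x₀ (μ j) : ℝ) : ℂ) * ∑ i, star (ψ i) * x i j).re := by
  have key : ∀ i, 0 ≤ (((dslope f x₀ (l i) : ℝ) : ℂ) * (star (ψ i) * ψ i)
      - ∑ j, ((dslope f x₀ (μ j) : ℝ) : ℂ) * (star (ψ i) * x i j)
      - ∑ j, ((dslope f x₀ (μ j) : ℝ) : ℂ) * (star (x i j) * ψ i)
      + ∑ j, ∑ k, (((dslope f x₀ (μ j) : ℝ) : ℂ)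
        + (μ k - l i) * ((dslope (dslope f (μ j)) x₀ (μ k) : ℝ) : ℂ)) * (star (x i j) * x i k)).re := by
    intro i
    have h := hf.re_sum_dslope_nonneg hI hd hx₀ (hl i) (hl' i) (a := Fin.cons (l i) μ)
      (Fin.cases (hl i) hμ) (Fin.cases (hl' i) hμ')
      (Fin.cons (ψ i) fun j => - x i j)
    simp only [Fin.sum_univ_succ (n := n), Fin.cons_zero, Fin.cons_succ,
      dslope_add_mul_dslope_dslope f (hl' i), dslope_add_mul_dslope_dslope f (hμ' _),
      dslope_add_mul_dslope_dslope_self f (hl' i) (hμ' _), sub_self, zero_mul, add_zero] at h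
    convert h using 2
    rw [Finset.sum_add_distrib]
    have e1 : ∑ j, ((dslope f x₀ (μ j) : ℝ) : ℂ) * (star (ψ i) * x i j) =
        - ∑ j, star (ψ i) * -x i j * ((dslope f x₀ (μ j) : ℝ) : ℂ) := by
      rw [← Finset.sum_neg_distrib]
      exact Finset.sum_congr rfl fun j _ => by ring
    have e2 : ∑ j, ((dslope f x₀ (μ j) : ℝ) : ℂ) * (star (x i j) * ψ i) =
        - ∑ j, star (-x i j) * ψ i * ((dslope f x₀ (μ j) : ℝ) : ℂ) := by
      rw [← Finset.sum_neg_distrib]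
      exact Finset.sum_congr rfl fun j _ => by rw [star_neg]; ring
    have e3 : ∑ j, ∑ k, (((dslope f x₀ (μ j) : ℝ) : ℂ)
        + (μ k - l i) * ((dslope (dslope f (μ j)) x₀ (μ k) : ℝ) : ℂ)) * (star (x i j) * x i k) =
        ∑ j, ∑ k, star (-x i j) * -x i k * ((dslope f x₀ (μ j)
        + (μ k - l i) * dslope (dslope f (μ j)) x₀ (μ k) : ℝ) : ℂ) :=
      Finset.sum_congr rfl fun j _ => Finset.sum_congr rfl fun k _ => by
        rw [star_neg]; push_cast; ring
    rw [e1, e2, e3]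
    ring
  have hsum := Finset.sum_nonneg fun i (_ : i ∈ Finset.univ) => key i
  rw [← Complex.re_sum] at hsum
  refine hsum.trans_eq (congrArg Complex.re ?_)
  rw [Finset.sum_add_distrib, Finset.sum_sub_distrib, Finset.sum_sub_distrib]
  have a1 : ∑ i, ∑ j, ((dslope f x₀ (μ j) : ℝ) : ℂ) * (star (ψ i) * x i j) =
      ∑ j, ((dslope f x₀ (μ j) : ℝ) : ℂ) * ∑ i, star (ψ i) * x i j := by
    rw [Finset.sum_comm]
    simp only [Finset.mul_sum]
  have a2 : ∑ i, ∑ j, ((dslope f x₀ (μ j) : ℝ) : ℂ) * (star (x i j) * ψ i) =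
      ∑ j, ((dslope f x₀ (μ j) : ℝ) : ℂ) * ∑ k, ∑ i, star (x i j) * x i k := by
    rw [Finset.sum_comm]
    refine Finset.sum_congr rfl fun j _ => ?_
    rw [← Finset.mul_sum]
    congr 1
    have := congrArg star (h2 j)
    simp only [star_sum, star_mul', star_star] at this
    calc _ = ∑ i, ψ i * star (x i j) := Finset.sum_congr rfl fun i _ => mul_comm _ _
      _ = _ := this
      _ = _ := Finset.sum_congr rfl fun k _ => Finset.sum_congr rfl fun i _ => mul_comm _ _
  have a3 : ∑ i, ∑ j, ∑ k, (((dslope f x₀ (μ j) : ℝ) : ℂ)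
        + (μ k - l i) * ((dslope (dslope f (μ j)) x₀ (μ k) : ℝ) : ℂ)) * (star (x i j) * x i k) =
      ∑ j, ((dslope f x₀ (μ j) : ℝ) : ℂ) * ∑ k, ∑ i, star (x i j) * x i k := by
    rw [Finset.sum_comm]
    refine Finset.sum_congr rfl fun j _ => ?_
    rw [Finset.sum_comm, Finset.mul_sum]
    refine Finset.sum_congr rfl fun k _ => ?_
    have h : ∀ i, (((dslope f x₀ (μ j) : ℝ) : ℂ)
        + (μ k - l i) * ((dslope (dslope f (μ j)) x₀ (μ k) : ℝ) : ℂ)) * (star (x i j) * x i k) =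
        (((dslope f x₀ (μ j) : ℝ) : ℂ) + μ k * ((dslope (dslope f (μ j)) x₀ (μ k) : ℝ) : ℂ))
          * (star (x i j) * x i k)
        - ((dslope (dslope f (μ j)) x₀ (μ k) : ℝ) : ℂ) * ((l i : ℂ) * (star (x i j) * x i k)) :=
      fun i => by ring
    simp only [h]
    rw [Finset.sum_sub_distrib, ← Finset.mul_sum, ← Finset.mul_sum, h1]
    ring
  rw [a1, a2, a3]
  ring

theorem OperatorMonotoneOn.re_sum_dslope_sub_nonneg {f : ℝ → ℝ} {I : Set ℝ}
    (hf : OperatorMonotoneOn f I) (hI : IsOpen I) (hIc : Convex ℝ I)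
    (hd : ∀ x ∈ I, DifferentiableAt ℝ f x)
    {x₀ : ℝ} (hx₀ : x₀ ∈ I) {n : ℕ} {l μ : Fin n → ℝ} (hl : ∀ i, l i ∈ I)
    (ψ : Fin n → ℂ) (x : Fin n → Fin n → ℂ)
    (h1 : ∀ j k, ∑ i, (l i : ℂ) * (star (x i j) * x i k) = μ k * ∑ i, star (x i j) * x i k)
    (h2 : ∀ j, ∑ i, star (ψ i) * x i j = ∑ k, ∑ i, star (x i k) * x i j) :
    0 ≤ (∑ i, ((dslope f x₀ (l i) : ℝ) : ℂ) * (star (ψ i) * ψ i) -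
      ∑ j, ((dslope f x₀ (μ j) : ℝ) : ℂ) * ∑ i, star (ψ i) * x i j).re := by
  wlog hμ : ∀ j, μ j ∈ I generalizing μ
  · classical
    let μ' : Fin n → ℝ := fun j => if μ j ∈ I then μ j else x₀
    have hx : ∀ j, μ j ∉ I → ∀ i, x i j = 0 := by
      intro j hj
      by_contra! hne
      obtain ⟨i₀, hi₀⟩ := hne
      apply hj
      have hpos : 0 < ∑ i, Complex.normSq (x i j) :=
        Finset.sum_pos' (fun i _ => Complex.normSq_nonneg _)
          ⟨i₀, Finset.mem_univ _, Complex.normSq_pos.2 hi₀⟩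
      have hr : ∑ i, l i * Complex.normSq (x i j) = μ j * ∑ i, Complex.normSq (x i j) := by
        have := h1 j j
        simp only [Complex.star_def, ← Complex.normSq_eq_conj_mul_self] at this
        exact_mod_cast this
      have hmem := hIc.sum_mem (t := Finset.univ) (z := l)
        (w := fun i => Complex.normSq (x i j) / ∑ i, Complex.normSq (x i j))
        (fun i _ => div_nonneg (Complex.normSq_nonneg _) hpos.le)
        (by rw [← Finset.sum_div, div_self hpos.ne']) (fun i _ => hl i)
      convert hmem using 1
      rw [eq_div_of_mul_eq hpos.ne' hr.symm, Finset.sum_div]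
      exact Finset.sum_congr rfl fun i _ => by rw [smul_eq_mul]; ring
    have h := this (μ := μ') (fun j k => by
        by_cases hk : μ k ∈ I
        · simpa [μ', hk] using h1 j k
        · simp [hx k hk]) (fun j => by simp only [μ']; split_ifs with h <;> assumption)
    refine h.trans_eq (congrArg Complex.re (congrArg _ (Finset.sum_congr rfl fun j _ => ?_)))
    by_cases hj : μ j ∈ I
    · simp [μ', hj]
    · simp [hx j hj]
  have hcont : ContinuousOn (dslope f x₀) I := (continuousOn_dslope (hI.mem_nhds hx₀)).2
    ⟨fun x hx => (hd x hx).continuousAt.continuousWithinAt, hd _ hx₀⟩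
  have hev : ∀ y ∈ I, ∀ᶠ t in nhdsWithin (0 : ℝ) {0}ᶜ, y + t ∈ I ∧ y + t ≠ x₀ := by
    intro y hy
    have hct : Filter.Tendsto (fun t : ℝ => y + t) (nhds 0) (nhds y) := by
      simpa using (continuous_const_add y).tendsto 0
    refine Filter.Eventually.and (nhdsWithin_le_nhds (hct (hI.mem_nhds hy))) ?_
    by_cases h : y = x₀
    · filter_upwards [self_mem_nhdsWithin] with t ht
      simpa [h] using ht
    · exact nhdsWithin_le_nhds (hct (isOpen_ne.mem_nhds h))
  have hlim : ∀ y ∈ I, Filter.Tendsto (fun t => ((dslope f x₀ (y + t) : ℝ) : ℂ))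
      (nhdsWithin (0 : ℝ) {0}ᶜ) (nhds ((dslope f x₀ y : ℝ) : ℂ)) := by
    intro y hy
    have hct : Filter.Tendsto (fun t : ℝ => y + t) (nhds 0) (nhds y) := by
      simpa using (continuous_const_add y).tendsto 0
    exact ((Complex.continuous_ofReal.tendsto _).comp
      ((hcont.continuousAt (hI.mem_nhds hy)).tendsto.comp hct)).mono_left nhdsWithin_le_nhds
  refine ge_of_tendsto (x := nhdsWithin (0 : ℝ) {0}ᶜ) (f := fun t : ℝ =>
    (∑ i, ((dslope f x₀ (l i + t) : ℝ) : ℂ) * (star (ψ i) * ψ i) -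
      ∑ j, ((dslope f x₀ (μ j + t) : ℝ) : ℂ) * ∑ i, star (ψ i) * x i j).re) ?_ ?_
  · refine (Complex.continuous_re.tendsto _).comp (Filter.Tendsto.sub ?_ ?_)
    · exact tendsto_finsetSum _ fun i _ => (hlim _ (hl i)).mul_const _
    · exact tendsto_finsetSum _ fun i _ => (hlim _ (hμ i)).mul_const _
  · filter_upwards [Filter.eventually_all.2 fun i => hev _ (hl i),
      Filter.eventually_all.2 fun i => hev _ (hμ i)] with t ht1 ht2
    refine hf.re_sum_dslope_sub_nonneg_of_ne hI hd hx₀ (fun i => (ht1 i).1) (fun i => (ht1 i).2)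
      (fun i => (ht2 i).1) (fun i => (ht2 i).2) ψ x (fun j k => ?_) h2
    push_cast
    simp only [add_mul, Finset.sum_add_distrib, h1, ← Finset.mul_sum]

theorem OperatorMonotoneOn.dslope_combo_le {f : ℝ → ℝ} {I : Set ℝ}
    (hf : OperatorMonotoneOn f I) (hI : Convex ℝ I) {c σ : ℝ} (hc : c ∈ I) (hσ : σ = 1 ∨ σ = -1)
    {y t : Fin 2 → ℝ} (hy : ∀ i, y i ∈ I) (hyc : ∀ i, 0 < σ * (y i - c)) (ht : ∀ i, 0 ≤ t i)
    (ht1 : ∑ i, t i = 1) :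
    dslope f c (∑ i, t i * y i) ≤ ∑ i, t i * dslope f c (y i) := by
  have hσ2 : σ * σ = 1 := by rcases hσ with rfl | rfl <;> simp
  let e : Fin 2 → ℝ := fun i => √(σ * (y i - c))
  let p : Fin 2 → ℝ := fun i => √(t i)
  have he : ∀ i, 0 < e i := fun i => Real.sqrt_pos.2 (hyc i)
  have he2 : ∀ i, e i ^ 2 = σ * (y i - c) := fun i => Real.sq_sqrt (hyc i).le
  have hp2 : ∀ i, p i ^ 2 = t i := fun i => Real.sq_sqrt (ht i)
  obtain ⟨M, hM⟩ : ∃ M, M = ∑ i, t i * y i := ⟨_, rfl⟩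
  rw [← hM]
  have hMI : M ∈ I := by
    rw [hM]
    exact hI.sum_mem (fun i _ => ht i) ht1 fun i _ => hy i
  rw [Fin.sum_univ_two] at hM ht1
  have hMc : M ≠ c := by
    intro h
    have h0 : t 0 * (σ * (y 0 - c)) + t 1 * (σ * (y 1 - c)) = 0 := by
      linear_combination (-σ) * hM + σ * h - σ * c * ht1
    have a0 := mul_nonneg (ht 0) (hyc 0).le
    have a1 := mul_nonneg (ht 1) (hyc 1).le
    have b0 : t 0 = 0 := (mul_eq_zero.1 (by linarith)).resolve_right (hyc 0).ne'
    have b1 : t 1 = 0 := (mul_eq_zero.1 (by linarith)).resolve_right (hyc 1).ne'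
    simp [b0, b1] at ht1
  let w : Fin 2 → ℂ := fun i => ((p i * e i : ℝ) : ℂ)
  let u : Fin 2 → ℂ := ![((p 1 * e 0 : ℝ) : ℂ), ((-(p 0 * e 1) : ℝ) : ℂ)]
  let D : Matrix (Fin 2) (Fin 2) ℂ := diagonal fun i => (y i : ℂ)
  let A : Matrix (Fin 2) (Fin 2) ℂ := (c : ℂ) • 1 + (σ : ℂ) • vecMulVec w w
  have hstar : ∀ q : Fin 2 → ℝ, (vecMulVec (fun i => (q i : ℂ)) fun i => (q i : ℂ)).PosSemidef := by
    intro q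
    have h := posSemidef_vecMulVec_self_star fun i => (q i : ℂ)
    have hq : star (fun i => (q i : ℂ)) = fun i => (q i : ℂ) := by
      funext i
      simp
    rwa [hq] at h
  have hD : D.IsHermitian := by
    rw [Matrix.isHermitian_diagonal_iff]; intro i; simp [isSelfAdjoint_iff]
  have hA : A.IsHermitian := by
    have := (hstar fun i => p i * e i).isHermitian
    simp only [IsHermitian] at this ⊢
    simp only [A, w, conjTranspose_add, conjTranspose_smul, this]
    simp
  have hNM : (A - (c : ℂ) • 1) * (A - (M : ℂ) • 1) = 0 := by
    have h1 : w ⬝ᵥ w = σ * (M - c) := by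
      simp only [dotProduct, Fin.sum_univ_two, w]
      have : p 0 * e 0 * (p 0 * e 0) + p 1 * e 1 * (p 1 * e 1) = σ * (M - c) := by
        linear_combination e 0 ^ 2 * hp2 0 + e 1 ^ 2 * hp2 1 + t 0 * he2 0 + t 1 * he2 1
          - σ * hM - σ * c * ht1
      exact_mod_cast this
    have h2 : A - (c : ℂ) • 1 = (σ : ℂ) • vecMulVec w w := by simp [A]
    have h3 : A - (M : ℂ) • 1 = (σ : ℂ) • vecMulVec w w - ((M : ℂ) - c) • 1 := by
      rw [sub_smul, ← h2]; abel
    have hσ2' : (σ : ℂ) * σ = 1 := by exact_mod_cast hσ2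
    rw [h2, h3, mul_sub, smul_mul_smul_comm, vecMulVec_mul_vecMulVec, h1, hσ2', one_smul,
      mul_smul_comm, mul_one, smul_smul, vecMulVec_smul, mul_comm, sub_self]
  have hcfc : ∀ g : ℝ → ℝ, cfc g A =
      (g c : ℂ) • 1 + ((dslope g c M : ℝ) : ℂ) • (A - (c : ℂ) • 1) := by
    intro g
    rw [hA.cfc_eq_add_dslope g c, hA.cfc_eq_add_dslope (dslope g c) M, mul_add, ← mul_assoc, hNM,
      zero_mul, add_zero, mul_smul_comm, mul_one]
  have hDI : spectrum ℝ D ⊆ I := (spectrum_diagonal_ofReal y).trans <| by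
    rintro _ ⟨i, rfl⟩
    exact hy i
  have hAI : spectrum ℝ A ⊆ I := by
    intro x hx
    have h := hcfc fun x => (x - c) * (x - M)
    rw [dslope_of_ne _ hMc, slope_def_field] at h
    simp only [sub_self, mul_zero, zero_mul, zero_div, Complex.ofReal_zero, zero_smul,
      add_zero] at h
    have h2 : (x - c) * (x - M) ∈ spectrum ℝ (cfc (fun x => (x - c) * (x - M)) A) :=
      (cfc_map_spectrum (p := IsSelfAdjoint) _ A hA (continuousOn_spectrum A _)).ge ⟨x, hx, rfl⟩
    rw [h, spectrum.zero_eq, mem_singleton_iff, mul_eq_zero, sub_eq_zero, sub_eq_zero] at h2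
    rcases h2 with rfl | rfl <;> assumption
  have hDA : D - A = (σ : ℂ) • vecMulVec u u := by
    have c0 : y 0 - (c + σ * (p 0 * e 0 * (p 0 * e 0))) = σ * (p 1 * e 0 * (p 1 * e 0)) := by
      linear_combination (-(σ * e 0 ^ 2)) * (hp2 0 + hp2 1 + ht1) - σ * he2 0 - (y 0 - c) * hσ2
    have c1 : y 1 - (c + σ * (p 1 * e 1 * (p 1 * e 1))) = σ * (p 0 * e 1 * (p 0 * e 1)) := by
      linear_combination (-(σ * e 1 ^ 2)) * (hp2 0 + hp2 1 + ht1) - σ * he2 1 - (y 1 - c) * hσ2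
    ext i j
    fin_cases i <;> fin_cases j <;> simp [D, A, u, w, vecMulVec_apply]
    · exact_mod_cast c0
    · exact Or.inl (by ring)
    · exact Or.inl (by ring)
    · exact_mod_cast c1
  have hu : (vecMulVec u u).PosSemidef := by
    convert hstar ![p 1 * e 0, -(p 0 * e 1)] using 2 <;>
    · funext i
      fin_cases i <;> simp [u]
  have hpos : ((σ : ℂ) • (cfc f D - cfc f A)).PosSemidef := by
    rcases hσ with rfl | rfl
    · simpa using hf.posSemidef_cfc_sub two_pos hA hD hAI hDI (by simpa [hDA] using hu)
    · simpa using hf.posSemidef_cfc_sub two_pos hD hA hDI hAI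
        (by rw [← neg_sub, hDA]; simpa using hu)
  obtain ⟨v, hv⟩ : ∃ v : Fin 2 → ℝ, ∀ i, v i * e i = p i :=
    ⟨fun i => p i / e i, fun i => div_mul_cancel₀ _ (he i).ne'⟩
  have h := hpos.dotProduct_mulVec_nonneg fun i => (v i : ℂ)
  have hF : ∀ i, v i * v i * (σ * (f (y i) - f c)) = t i * dslope f c (y i) := by
    intro i
    have := sub_smul_dslope f c (y i)
    rw [smul_eq_mul] at this
    rw [← this, ← hp2 i, ← hv i, mul_pow, he2]
    ring
  have hcalc : star (fun i => (v i : ℂ)) ⬝ᵥ (((σ : ℂ) • (cfc f D - cfc f A)) *ᵥ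
      fun i => (v i : ℂ)) = ((∑ i, t i * dslope f c (y i) - dslope f c M : ℝ) : ℂ) := by
    have h1 : ∑ i, ∑ j, v i * (σ * ((if i = j then f (y i) else 0) - ((if i = j then f c else 0) +
        dslope f c M * (σ * (p i * e i * (p j * e j)))))) * v j =
        ∑ i, t i * dslope f c (y i) - dslope f c M := by
      simp only [Fin.sum_univ_two, ← hF]
      have hQ : v 0 * e 0 * p 0 + v 1 * e 1 * p 1 = 1 := by
        linear_combination p 0 * hv 0 + p 1 * hv 1 + hp2 0 + hp2 1 + ht1
      simp only [if_true, zero_ne_one, one_ne_zero, if_false]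
      linear_combination (-(dslope f c M * (v 0 * e 0 * p 0 + v 1 * e 1 * p 1) ^ 2)) * hσ2
        - dslope f c M * (v 0 * e 0 * p 0 + v 1 * e 1 * p 1 + 1) * hQ
    rw [← h1, hcfc]
    simp only [D, A, dotProduct, mulVec, Finset.mul_sum, Matrix.smul_apply, Matrix.sub_apply,
      Matrix.add_apply, cfc_diagonal_apply, add_sub_cancel_left, vecMulVec_apply, w, one_apply]
    push_cast
    refine Finset.sum_congr rfl fun i _ => Finset.sum_congr rfl fun j _ => ?_
    split_ifs <;> simp <;> ring
  rw [hcalc] at h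
  have := Complex.zero_le_real.1 h
  linarith

theorem OperatorMonotoneOn.convexOn_dslope {f : ℝ → ℝ} {I : Set ℝ}
    (hf : OperatorMonotoneOn f I) (hI : Convex ℝ I) {c σ : ℝ} (hc : c ∈ I)
    (hσ : σ = 1 ∨ σ = -1) : ConvexOn ℝ {y ∈ I | 0 < σ * (y - c)} (dslope f c) := by
  have hcomb : ∀ {x y a b : ℝ}, 0 < σ * (x - c) → 0 < σ * (y - c) → 0 ≤ a → 0 ≤ b → a + b = 1 →
      0 < σ * (a * x + b * y - c) := by
    intro x y a b hx hy ha hb hab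
    have h : σ * (a * x + b * y - c) = a * (σ * (x - c)) + b * (σ * (y - c)) := by
      linear_combination σ * c * hab
    rw [h]
    rcases ha.eq_or_lt with rfl | ha
    · rw [zero_add] at hab
      simpa [hab] using hy
    · exact add_pos_of_pos_of_nonneg (mul_pos ha hx) (mul_nonneg hb hy.le)
  refine ⟨fun x hx y hy a b ha hb hab => ⟨hI hx.1 hy.1 ha hb hab, hcomb hx.2 hy.2 ha hb hab⟩,
    fun x hx y hy a b ha hb hab => ?_⟩
  have := hf.dslope_combo_le hI hc hσ (y := ![x, y]) (t := ![a, b]) (by simp [hx.1, hy.1])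
    (by simp [hx.2, hy.2]) (by simp [ha, hb]) (by simpa using hab)
  simpa using this

theorem OperatorMonotoneOn.exists_hasDerivWithinAt {f : ℝ → ℝ} {I : Set ℝ}
    (hf : OperatorMonotoneOn f I) (hIo : IsOpen I) (hI : Convex ℝ I) {c x σ : ℝ} (hc : c ∈ I)
    (hx : x ∈ I) (hσ : σ = 1 ∨ σ = -1) (hxc : 0 < σ * (x - c)) :
    ∃ a b, HasDerivWithinAt f a (Iio x) x ∧ HasDerivWithinAt f b (Ioi x) x ∧ 0 ≤ σ * (b - a) := by
  have hF := hf.convexOn_dslope hI hc hσ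
  have hxs : x ∈ interior {y ∈ I | 0 < σ * (y - c)} := by
    refine mem_interior_iff_mem_nhds.2 (Filter.inter_mem (hIo.mem_nhds hx) ?_)
    exact (isOpen_lt continuous_const
      (continuous_const.mul (continuous_id.sub continuous_const))).mem_nhds hxc
  have key : ∀ {s : Set ℝ} {l : ℝ}, HasDerivWithinAt (dslope f c) l s x →
      HasDerivWithinAt f (dslope f c x + (x - c) * l) s x := by
    intro s l h
    have h2 := (((hasDerivWithinAt_id x s).sub_const c).mul h).const_add (f c)
    have he : f = fun y => f c + (y - c) * dslope f c y := by
      funext y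
      rw [← smul_eq_mul, sub_smul_dslope]
      ring
    rw [he]
    simpa [← he] using h2
  refine ⟨_, _, key (hF.hasDerivWithinAt_leftDeriv_of_mem_interior hxs),
    key (hF.hasDerivWithinAt_rightDeriv_of_mem_interior hxs), ?_⟩
  have := mul_nonneg hxc.le (sub_nonneg.2 (hF.leftDeriv_le_rightDeriv_of_mem_interior hxs))
  linarith

theorem OperatorMonotoneOn.differentiableAt {f : ℝ → ℝ} {I : Set ℝ}
    (hf : OperatorMonotoneOn f I) (hIo : IsOpen I) (hI : Convex ℝ I) {x : ℝ} (hx : x ∈ I) :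
    DifferentiableAt ℝ f x := by
  obtain ⟨ε, hε, hball⟩ := Metric.isOpen_iff.1 hIo x hx
  obtain ⟨a, b, ha, hb, hab⟩ := hf.exists_hasDerivWithinAt hIo hI (c := x - ε / 2) (σ := 1)
    (hball (by simp [abs_of_pos hε, hε])) hx (Or.inl rfl) (by linarith)
  obtain ⟨a', b', ha', hb', hab'⟩ := hf.exists_hasDerivWithinAt hIo hI (c := x + ε / 2) (σ := -1)
    (hball (by simp [abs_of_pos hε, hε])) hx (Or.inr rfl) (by linarith)
  have h1 := (uniqueDiffWithinAt_Iio x).eq_deriv _ ha ha'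
  have h2 := (uniqueDiffWithinAt_Ioi x).eq_deriv _ hb hb'
  have h3 : b = a := by linarith
  subst h3
  have := (hasDerivWithinAt_Iio_iff_Iic.1 ha).union (hasDerivWithinAt_Ioi_iff_Ici.1 hb)
  rw [Iic_union_Ici, hasDerivWithinAt_univ] at this
  exact this.differentiableAt

theorem Matrix.IsHermitian.exists_cfc_eq {n : ℕ} {A : Matrix (Fin n) (Fin n) ℂ}
    (hA : A.IsHermitian) : ∃ U : Matrix (Fin n) (Fin n) ℂ, Uᴴ * U = 1 ∧ U * Uᴴ = 1 ∧
      A = U * diagonal (fun i => (hA.eigenvalues i : ℂ)) * Uᴴ ∧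
      ∀ g : ℝ → ℝ, hA.cfc g = U * diagonal (fun i => (g (hA.eigenvalues i) : ℂ)) * Uᴴ := by
  refine ⟨hA.eigenvectorUnitary, Unitary.coe_star_mul_self _, Unitary.coe_mul_star_self _, ?_,
    fun g => ?_⟩
  · conv_lhs => rw [hA.spectral_theorem, Unitary.conjStarAlgAut_apply]
    rfl
  · rw [IsHermitian.cfc, Unitary.conjStarAlgAut_apply]
    rfl

theorem Matrix.star_dotProduct_conj_diagonal_mulVec {n : ℕ} (U : Matrix (Fin n) (Fin n) ℂ)
    (d ψ : Fin n → ℂ) : star ψ ⬝ᵥ ((U * diagonal d * Uᴴ) *ᵥ ψ) =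
      ∑ i, d i * (star ((Uᴴ *ᵥ ψ) i) * (Uᴴ *ᵥ ψ) i) := by
  rw [← mulVec_mulVec, ← mulVec_mulVec, dotProduct_mulVec, ← conjTranspose_conjTranspose U,
    ← star_mulVec, conjTranspose_conjTranspose]
  simp only [dotProduct, mulVec_diagonal, Pi.star_apply]
  exact Finset.sum_congr rfl fun i _ => by ring

theorem OperatorMonotoneOn.stronglyOperatorConvexOn_dslope {f : ℝ → ℝ} {I : Set ℝ}
    (hf : OperatorMonotoneOn f I) (hIo : IsOpen I) (hI : Convex ℝ I) {x₀ : ℝ} (hx₀ : x₀ ∈ I) :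
    StronglyOperatorConvexOn (dslope f x₀) I := by
  refine ⟨x₀, hx₀, fun n _ P H hP hPP hH hK hHI => ?_⟩
  obtain ⟨K, hKdef⟩ : ∃ K, K = P * H * P + (x₀ : ℂ) • ((1 : Matrix (Fin n) (Fin n) ℂ) - P) :=
    ⟨_, rfl⟩
  revert hK
  rw [← hKdef]
  intro hK
  obtain ⟨U, -, hU2, hHU, hUcfc⟩ := hH.exists_cfc_eq
  obtain ⟨V, hV1, hV2, hKV, hVcfc⟩ := hK.exists_cfc_eq
  have hcfcH : ∀ {A : Matrix (Fin n) (Fin n) ℂ} (hA : A.IsHermitian) (g : ℝ → ℝ),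
      (hA.cfc g).IsHermitian := fun {A} hA g => by
    rw [← hA.cfc_eq]
    exact cfc_predicate g A
  have hherm : (hH.cfc (dslope f x₀) - P * hK.cfc (dslope f x₀) * P).IsHermitian := by
    refine (hcfcH hH _).sub ?_
    simp [IsHermitian, conjTranspose_mul, hP.eq, (hcfcH hK _).eq, mul_assoc]
  refine PosSemidef.of_dotProduct_mulVec_nonneg hherm fun ψ => ?_
  let q : Fin n → ℂ := Vᴴ *ᵥ (P *ᵥ ψ)
  let W : Matrix (Fin n) (Fin n) ℂ := Uᴴ * P * V
  have hWW : Wᴴ * W = Vᴴ * P * V := by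
    calc Wᴴ * W = Vᴴ * (P * (U * Uᴴ) * P) * V := by simp [W, mul_assoc, hP.eq]
      _ = Vᴴ * P * V := by rw [hU2, mul_one, hPP]
  have hWL : Wᴴ * diagonal (fun i => (hH.eigenvalues i : ℂ)) * W =
      Wᴴ * W * diagonal (fun i => (hK.eigenvalues i : ℂ)) := by
    have hPK : P * H * P = P * K := by
      simp [hKdef, mul_add, mul_sub, ← mul_assoc, hPP]
    calc Wᴴ * diagonal (fun i => (hH.eigenvalues i : ℂ)) * W
        = Vᴴ * (P * (U * diagonal (fun i => (hH.eigenvalues i : ℂ)) * Uᴴ) * P) * V := by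
          simp [W, mul_assoc, hP.eq]
      _ = Vᴴ * (P * (V * diagonal (fun i => (hK.eigenvalues i : ℂ)) * Vᴴ)) * V := by
          rw [← hHU, ← hKV, hPK]
      _ = Vᴴ * P * V * diagonal (fun i => (hK.eigenvalues i : ℂ)) * (Vᴴ * V) := by
          simp only [mul_assoc]
      _ = _ := by rw [hV1, mul_one, hWW]
  have hψW : star (Uᴴ *ᵥ ψ) ᵥ* W = star q := by
    have : Wᴴ *ᵥ (Uᴴ *ᵥ ψ) = q := by
      calc Wᴴ *ᵥ (Uᴴ *ᵥ ψ) = (Vᴴ * (P * (U * Uᴴ))) *ᵥ ψ := by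
            simp [W, mul_assoc, hP.eq]
        _ = q := by simp [hU2, q]
    rw [← this, star_mulVec Wᴴ, conjTranspose_conjTranspose]
  have hqW : star q ᵥ* (Wᴴ * W) = star q := by
    have : (Wᴴ * W) *ᵥ q = q := by
      calc (Wᴴ * W) *ᵥ q = (Vᴴ * P * (V * Vᴴ) * P) *ᵥ ψ := by
            rw [hWW]
            simp [q, mul_assoc]
        _ = q := by
            rw [hV2, mul_one, mul_assoc, hPP]
            simp [q]
    conv_rhs => rw [← this, star_mulVec, conjTranspose_mul, conjTranspose_conjTranspose]
  have hsum : ∀ j, ∑ i, star ((Uᴴ *ᵥ ψ) i) * (W i j * q j) = star (q j) * q j := fun j => by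
    simp only [← mul_assoc, ← Finset.sum_mul]
    exact congrArg (· * q j) (congrFun hψW j)
  have hWWapply : ∀ j k, ∑ i, star (W i j * q j) * (W i k * q k) =
      star (q j) * (Wᴴ * W) j k * q k := fun j k => by
    simp only [mul_apply, conjTranspose_apply, Finset.mul_sum, Finset.sum_mul, star_mul']
    exact Finset.sum_congr rfl fun i _ => by ring
  have h := hf.re_sum_dslope_sub_nonneg hIo hI (fun x hx => hf.differentiableAt hIo hI hx) hx₀ hHI
    (μ := hK.eigenvalues) (Uᴴ *ᵥ ψ) (fun i j => W i j * q j) (fun j k => by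
      have := congrFun (congrFun hWL j) k
      rw [mul_diagonal, mul_assoc, mul_apply] at this
      simp only [diagonal_mul, conjTranspose_apply] at this
      calc _ = star (q j) * (∑ i, star (W i j) * ((hH.eigenvalues i : ℂ) * W i k)) * q k := by
            simp only [Finset.mul_sum, Finset.sum_mul, star_mul']
            exact Finset.sum_congr rfl fun i _ => by ring
        _ = _ := by
            rw [this, hWWapply]
            ring)
    (fun j => by
      simp only [hWWapply, hsum]
      rw [← Finset.sum_mul]
      exact congrArg (· * q j) (congrFun hqW j).symm)
  have hquad : star ψ ⬝ᵥ ((hH.cfc (dslope f x₀) - P * hK.cfc (dslope f x₀) * P) *ᵥ ψ) =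
      ∑ i, ((dslope f x₀ (hH.eigenvalues i) : ℝ) : ℂ) *
        (star ((Uᴴ *ᵥ ψ) i) * (Uᴴ *ᵥ ψ) i) -
      ∑ j, ((dslope f x₀ (hK.eigenvalues j) : ℝ) : ℂ) *
        ∑ i, star ((Uᴴ *ᵥ ψ) i) * (W i j * q j) := by
    have hP' : star ψ ⬝ᵥ ((P * hK.cfc (dslope f x₀) * P) *ᵥ ψ) =
        star (P *ᵥ ψ) ⬝ᵥ (hK.cfc (dslope f x₀) *ᵥ (P *ᵥ ψ)) := by
      rw [← mulVec_mulVec, ← mulVec_mulVec, dotProduct_mulVec, star_mulVec, hP.eq]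
    rw [sub_mulVec, dotProduct_sub, hP', hUcfc, hVcfc, star_dotProduct_conj_diagonal_mulVec,
      star_dotProduct_conj_diagonal_mulVec]
    simp only [hsum]
    rfl
  rw [← hquad] at h
  refine Complex.nonneg_iff.2 ⟨h, ?_⟩
  exact (hherm.im_star_dotProduct_mulVec_self ψ).symm

/-- if `f` is operator monotone on an open interval `I` and `x₀ ∈ I`, then `f` is
differentiable at `x₀` and `g(x) = (f(x) − f(x₀))/(x − x₀)` (with `g(x₀) = f′(x₀)`) is strongly
operator convex on `I`. -/
theorem stmt1 (I : Set ℝ) (hIopen : IsOpen I) (hI : Convex ℝ I) (hnt : I.Nontrivial)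
    (f : ℝ → ℝ) (hf : OperatorMonotoneOn f I) (x₀ : ℝ) (hx₀ : x₀ ∈ I) :
    DifferentiableAt ℝ f x₀ ∧
      StronglyOperatorConvexOn
        (fun x => if x = x₀ then deriv f x₀ else (f x - f x₀) / (x - x₀)) I := by
  refine ⟨hf.differentiableAt hIopen hI hx₀, ?_⟩
  convert hf.stronglyOperatorConvexOn_dslope hIopen hI hx₀ using 1
  funext x
  split_ifs with h
  · rw [h, dslope_same]
  · rw [dslope_of_ne f h, slope_def_field]
end

section
/- (Proposition 0.3(i)) Let I ⊆ ℝ be a nondegenerate interval with 0 ∈ I, let φ be operator monotone on I with φ(0) ≥ 0, let J ⊆ ℝ be a nondegenerate interval, and let f be strongly operator convex on J with f(J) ⊆ I. Then the composite φ∘f is strongly operator convex on J. -/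
open Matrix Set
open scoped ComplexOrder

/-- Evaluating a polynomial at the compression of `a` to a commuting idempotent `p`. -/
theorem aeval_mul_idempotent {R A : Type*} [CommRing R] [Ring A] [Algebra R A] {a p : A}
    (hap : Commute a p) (hp : p * p = p) (q : Polynomial R) :
    Polynomial.aeval (a * p) q =
      Polynomial.aeval a q * p + algebraMap R A (q.eval 0) * (1 - p) := by
  have hpp : IsIdempotentElem p := hp
  induction q using Polynomial.induction_on' with
  | add q r hq hr => simp only [map_add, Polynomial.eval_add, hq, hr]; noncomm_ring
  | monomial n c =>
    rcases Nat.eq_zero_or_pos n with rfl | hn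
    · simp only [Polynomial.monomial_zero_left, Polynomial.aeval_C, Polynomial.eval_C]
      noncomm_ring
    · simp [Polynomial.aeval_monomial, hap.mul_pow, hpp.pow_eq hn.ne', hn.ne', mul_assoc]

namespace Matrix

variable {n : Type*} [Fintype n] [DecidableEq n]

/-- The spectrum of the compression of `M` to a commuting projection. -/
theorem spectrum_mul_idempotent_subset {M P : Matrix n n ℂ} (hM : M.IsHermitian)
    (hMP : Commute M P) (hP : P * P = P) :
    spectrum ℝ (M * P) ⊆ insert 0 (spectrum ℝ M) := by
  intro μ hμ
  have hfin : (spectrum ℝ M).Finite := finite_real_spectrum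
  let q : Polynomial ℝ := Lagrange.nodal (insert 0 hfin.toFinset) id
  have hroot : ∀ x : ℝ, q.eval x = 0 ↔ x ∈ insert 0 (spectrum ℝ M) := by
    intro x
    simp [q, Lagrange.eval_nodal, Finset.prod_eq_zero_iff, sub_eq_zero]
  have h0 : Polynomial.aeval (M * P) q = 0 := by
    have hqM : Polynomial.aeval M q = 0 := by
      rw [← cfc_polynomial q M hM.isSelfAdjoint]
      exact (cfc_congr fun x hx => (hroot x).2 (Or.inr hx)).trans (cfc_const_zero ℝ M)
    rw [aeval_mul_idempotent hMP hP, hqM, (hroot 0).2 (Or.inl rfl)]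
    simp
  have hmem := spectrum.subset_polynomial_aeval (M * P) q ⟨μ, hμ, rfl⟩
  rw [h0] at hmem
  refine (hroot μ).1 ?_
  by_contra hne
  refine hmem ?_
  rw [spectrum.mem_resolventSet_iff, sub_zero]
  exact (IsUnit.mk0 _ hne).map _

/-- The functional calculus of the compression of `M` to a commuting projection. -/
theorem cfc_mul_idempotent {M P : Matrix n n ℂ} (hM : M.IsHermitian) (hPh : P.IsHermitian)
    (hMP : Commute M P) (hP : P * P = P) (g : ℝ → ℝ) :
    cfc g (M * P) = cfc g M * P + (g 0) • (1 - P) := by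
  have hMPh : (M * P).IsHermitian := by
    rw [IsHermitian, conjTranspose_mul, hM.eq, hPh.eq, hMP.eq]
  have hfin : (spectrum ℝ M).Finite := finite_real_spectrum
  let q : Polynomial ℝ := Lagrange.interpolate (insert 0 hfin.toFinset) id g
  have hq : ∀ x ∈ insert 0 (spectrum ℝ M), g x = q.eval x := by
    intro x hx
    exact (Lagrange.eval_interpolate_at_node (v := id) g Function.injective_id.injOn
      (by simpa using hx)).symm
  rw [cfc_congr (g := q.eval) fun x hx => hq x (spectrum_mul_idempotent_subset hM hMP hP hx),
    cfc_congr (a := M) (g := q.eval) fun x hx => hq x (Or.inr hx),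
    cfc_polynomial q _ hMPh.isSelfAdjoint, cfc_polynomial q _ hM.isSelfAdjoint,
    aeval_mul_idempotent hMP hP, hq 0 (Or.inl rfl), Algebra.smul_def]

theorem IsHermitian.posSemidef_one_sub_of_idempotent {P : Matrix n n ℂ} (hPh : P.IsHermitian)
    (hP : P * P = P) : (1 - P).PosSemidef := by
  have h := posSemidef_conjTranspose_mul_self (1 - P)
  rwa [conjTranspose_sub, hPh.eq, conjTranspose_one,
    (show IsIdempotentElem P from hP).one_sub.eq] at h

open scoped MatrixOrder in
/-- Compressing by a projection and adding `x₀` on the complement keeps the spectrum in a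
convex set. -/
theorem spectrum_compression_subset {J : Set ℝ} (hJ : Convex ℝ J) {x₀ : ℝ} (hx₀ : x₀ ∈ J)
    {P H : Matrix n n ℂ} (hPh : P.IsHermitian) (hP : P * P = P) (hH : H.IsHermitian)
    (hK : (P * H * P + (x₀ : ℂ) • (1 - P)).IsHermitian) (hHJ : ∀ i, hH.eigenvalues i ∈ J) :
    spectrum ℝ (P * H * P + (x₀ : ℂ) • (1 - P)) ⊆ J := by
  have hQ0 : 0 ≤ 1 - P := nonneg_iff_posSemidef.2 (hPh.posSemidef_one_sub_of_idempotent hP)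
  have hx : (x₀ : ℂ) • (1 - P) = x₀ • (1 - P) := by ext; simp
  let S : Finset ℝ := insert x₀ (Finset.univ.image hH.eigenvalues)
  have hS : S.Nonempty := Finset.insert_nonempty _ _
  have hSJ : ∀ x ∈ S, x ∈ J := by
    intro x hx
    rcases Finset.mem_insert.1 hx with rfl | hx
    · exact hx₀
    · obtain ⟨i, -, rfl⟩ := Finset.mem_image.1 hx
      exact hHJ i
  have hspec : ∀ x ∈ spectrum ℝ H, x ∈ S := by
    intro x hx
    rw [hH.spectrum_real_eq_range_eigenvalues] at hx
    obtain ⟨i, rfl⟩ := hx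
    exact Finset.mem_insert_of_mem (Finset.mem_image_of_mem _ (Finset.mem_univ i))
  have hsplit : ∀ r : ℝ, algebraMap ℝ (Matrix n n ℂ) r =
      star P * algebraMap ℝ (Matrix n n ℂ) r * P + r • (1 - P) := by
    intro r
    rw [star_eq_conjTranspose, hPh.eq, Algebra.algebraMap_eq_smul_one]
    simp [hP, smul_sub]
  have hlow : algebraMap ℝ _ (S.min' hS) ≤ P * H * P + (x₀ : ℂ) • (1 - P) := by
    rw [hsplit, hx]
    refine add_le_add ?_ (smul_le_smul_of_nonneg_right
      (S.min'_le _ (Finset.mem_insert_self _ _)) hQ0)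
    have h := star_left_conjugate_le_conjugate ((algebraMap_le_iff_le_spectrum
      (a := H) (r := S.min' hS) hH.isSelfAdjoint).2 fun x hx => S.min'_le x (hspec x hx)) P
    rwa [show star P * H * P = P * H * P by rw [star_eq_conjTranspose, hPh.eq]] at h
  have hup : P * H * P + (x₀ : ℂ) • (1 - P) ≤ algebraMap ℝ _ (S.max' hS) := by
    rw [hsplit, hx]
    refine add_le_add ?_ (smul_le_smul_of_nonneg_right
      (S.le_max' _ (Finset.mem_insert_self _ _)) hQ0)
    have h := star_left_conjugate_le_conjugate ((le_algebraMap_iff_spectrum_le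
      (a := H) (r := S.max' hS) hH.isSelfAdjoint).2 fun x hx => S.le_max' x (hspec x hx)) P
    rwa [show star P * H * P = P * H * P by rw [star_eq_conjTranspose, hPh.eq]] at h
  intro x hx
  exact hJ.ordConnected.out (hSJ _ (S.min'_mem hS)) (hSJ _ (S.max'_mem hS))
    ⟨(algebraMap_le_iff_le_spectrum hK.isSelfAdjoint).1 hlow x hx,
      (le_algebraMap_iff_spectrum_le hK.isSelfAdjoint).1 hup x hx⟩

end Matrix

/-- Proposition 0.3(i): if `φ` is operator monotone on `I` with `0 ∈ I` and
`φ(0) ≥ 0`, and `f` is strongly operator convex on `J` with `f(J) ⊆ I`, then `φ∘f` is strongly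
operator convex on `J`. -/
theorem stmt5 (I : Set ℝ) (hI : Convex ℝ I) (hnt : I.Nontrivial) (h0 : (0 : ℝ) ∈ I)
    (φ : ℝ → ℝ) (hφ : OperatorMonotoneOn φ I) (hφ0 : 0 ≤ φ 0)
    (J : Set ℝ) (hJ : Convex ℝ J) (hJnt : J.Nontrivial)
    (f : ℝ → ℝ) (hf : StronglyOperatorConvexOn f J) (hfJ : f '' J ⊆ I) :
    StronglyOperatorConvexOn (φ ∘ f) J := by
  obtain ⟨x₀, hx₀, hf⟩ := hf
  refine ⟨x₀, hx₀, fun n hn P H hPh hP hH hK hHJ => ?_⟩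
  have key := hf n hn P H hPh hP hH hK hHJ
  have hKJ := spectrum_compression_subset hJ hx₀ hPh hP hH hK hHJ
  rw [← hH.cfc_eq, ← hK.cfc_eq] at key ⊢
  set K := P * H * P + (x₀ : ℂ) • ((1 : Matrix (Fin n) (Fin n) ℂ) - P) with hKdef
  have hKP : Commute K P := by
    rw [Commute, SemiconjBy, hKdef]
    simp [add_mul, mul_add, sub_mul, mul_sub, mul_assoc, hP]
    simp [← mul_assoc, hP]
  have hcomm : ∀ g : ℝ → ℝ, P * cfc g K * P = cfc g K * P := fun g => by
    rw [← (hKP.cfc_real g).eq, mul_assoc, hP]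
  have hM : (cfc f K).IsHermitian := cfc_predicate f K
  have hN : (cfc f H).IsHermitian := cfc_predicate f H
  have hA : (cfc f K * P).IsHermitian := by
    rw [IsHermitian, conjTranspose_mul, hM.eq, hPh.eq, (hKP.cfc_real f).eq]
  have hcompK : cfc (φ ∘ f) K = cfc φ (cfc f K) :=
    cfc_comp φ f K hK.isSelfAdjoint
      ((finite_real_spectrum.image f).continuousOn φ) (finite_real_spectrum.continuousOn f)
  have hcompH : cfc (φ ∘ f) H = cfc φ (cfc f H) :=
    cfc_comp φ f H hH.isSelfAdjoint
      ((finite_real_spectrum.image f).continuousOn φ) (finite_real_spectrum.continuousOn f)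
  rw [hcomm] at key ⊢
  have hAI : ∀ i, hA.eigenvalues i ∈ I := fun i => by
    rcases spectrum_mul_idempotent_subset hM (hKP.cfc_real f) hP
      (hA.eigenvalues_mem_spectrum_real i) with h | h
    · rwa [h]
    · rw [cfc_map_spectrum f K hK.isSelfAdjoint (finite_real_spectrum.continuousOn f)] at h
      exact hfJ (image_mono hKJ h)
  have hNI : ∀ i, hN.eigenvalues i ∈ I := fun i => by
    have h := hN.eigenvalues_mem_spectrum_real i
    rw [cfc_map_spectrum f H hH.isSelfAdjoint (finite_real_spectrum.continuousOn f)] at h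
    refine hfJ (image_mono ?_ h)
    rw [hH.spectrum_real_eq_range_eigenvalues]
    rintro _ ⟨j, rfl⟩
    exact hHJ j
  have hmono := hφ n hn _ _ hA hN hAI hNI key
  rw [← hA.cfc_eq, ← hN.cfc_eq, cfc_mul_idempotent hM hPh (hKP.cfc_real f) hP] at hmono
  rw [hcompH, hcompK]
  convert hmono.add ((hPh.posSemidef_one_sub_of_idempotent hP).smul hφ0) using 1
  abel
end

section
/- (Proposition 0.4) Let I ⊆ ℝ be a nondegenerate interval and let φ : I → ℝ. Suppose that for every nondegenerate interval J ⊆ ℝ and every function f that is operator convex on J with f(J) ⊆ I, the composite φ∘f is operator convex on J. Then φ is both operator monotone and operator convex on I. -/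
open Matrix Set
open scoped ComplexOrder

section Loewner

open scoped MatrixOrder Matrix.Norms.L2Operator

variable {n : ℕ}

local notation "Mat" => Matrix (Fin n) (Fin n) ℂ

theorem continuousOn_spectrum_real (f : ℝ → ℝ) (A : Mat) : ContinuousOn f (spectrum ℝ A) :=
  A.finite_real_spectrum.continuousOn f

theorem forall_eigenvalues_mem_iff {A : Mat} (hA : A.IsHermitian) {I : Set ℝ} :
    (∀ i, hA.eigenvalues i ∈ I) ↔ spectrum ℝ A ⊆ I := by
  rw [hA.spectrum_real_eq_range_eigenvalues, Set.range_subset_iff]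

theorem spectrum_subset_Icc_iff {A : Mat} (hA : IsSelfAdjoint A) {a b : ℝ} :
    spectrum ℝ A ⊆ Set.Icc a b ↔ algebraMap ℝ Mat a ≤ A ∧ A ≤ algebraMap ℝ Mat b := by
  rw [algebraMap_le_iff_le_spectrum hA, le_algebraMap_iff_spectrum_le hA]
  exact ⟨fun h => ⟨fun x hx => (h hx).1, fun x hx => (h hx).2⟩,
    fun h x hx => ⟨h.1 x hx, h.2 x hx⟩⟩

theorem cfc_comp_matrix (g f : ℝ → ℝ) {A : Mat} (hA : IsSelfAdjoint A) :
    cfc (g ∘ f) A = cfc g (cfc f A) :=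
  cfc_comp g f A hA ((A.finite_real_spectrum.image f).continuousOn g)
    (continuousOn_spectrum_real f A)

theorem isStrictlyPositive_of_spectrum_subset {A : Mat} (hA : IsSelfAdjoint A) {a : ℝ}
    (ha : 0 < a) (h : spectrum ℝ A ⊆ Set.Ici a) : IsStrictlyPositive A :=
  IsStrictlyPositive.of_le (isStrictlyPositive_algebraMap ha)
    ((algebraMap_le_iff_le_spectrum hA).2 h)

theorem isSelfAdjoint_smul_add_smul {A B : Mat} (hA : IsSelfAdjoint A) (hB : IsSelfAdjoint B)
    (t : ℝ) : IsSelfAdjoint (t • A + (1 - t) • B) :=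
  ((IsSelfAdjoint.all t).smul hA).add ((IsSelfAdjoint.all (1 - t)).smul hB)

theorem operatorConvexOn_iff_cfc_le (f : ℝ → ℝ) (I : Set ℝ) :
    OperatorConvexOn f I ↔ ∀ n : ℕ, 0 < n → ∀ t ∈ Set.Icc (0 : ℝ) 1,
      ∀ A B : Matrix (Fin n) (Fin n) ℂ,
      IsSelfAdjoint A → IsSelfAdjoint B → spectrum ℝ A ⊆ I → spectrum ℝ B ⊆ I →
      cfc f (t • A + (1 - t) • B) ≤ t • cfc f A + (1 - t) • cfc f B := by
  have key (n : ℕ) (t : ℝ) (A B : Matrix (Fin n) (Fin n) ℂ) :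
      (t : ℂ) • A + ((1 : ℂ) - (t : ℂ)) • B = t • A + (1 - t) • B := by
    ext i j
    simp
  constructor
  · intro h n hn t ht A B hA hB sA sB
    have hAB : ((t : ℂ) • A + ((1 : ℂ) - (t : ℂ)) • B).IsHermitian := by
      rw [key]
      exact isSelfAdjoint_smul_add_smul hA hB t
    have hA' : A.IsHermitian := hA
    have hB' : B.IsHermitian := hB
    have := h n hn t ht A B hA' hB' hAB ((forall_eigenvalues_mem_iff _).2 sA)
      ((forall_eigenvalues_mem_iff _).2 sB)
    rw [← Matrix.IsHermitian.cfc_eq, ← Matrix.IsHermitian.cfc_eq, ← Matrix.IsHermitian.cfc_eq,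
      key, key] at this
    exact this
  · intro h n hn t ht A B hA hB hAB sA sB
    rw [← Matrix.IsHermitian.cfc_eq, ← Matrix.IsHermitian.cfc_eq, ← Matrix.IsHermitian.cfc_eq,
      key, key]
    exact h n hn t ht A B hA hB ((forall_eigenvalues_mem_iff _).1 sA)
      ((forall_eigenvalues_mem_iff _).1 sB)

theorem operatorConvexOn_id (I : Set ℝ) : OperatorConvexOn id I := by
  rw [operatorConvexOn_iff_cfc_le]
  intro n hn t ht A B hA hB _ _
  rw [cfc_id ℝ A hA, cfc_id ℝ B hB, cfc_id ℝ _ (isSelfAdjoint_smul_add_smul hA hB t)]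

theorem OperatorConvexOn.const_add {f : ℝ → ℝ} {I : Set ℝ} (hf : OperatorConvexOn f I) (c : ℝ) :
    OperatorConvexOn (fun x => c + f x) I := by
  rw [operatorConvexOn_iff_cfc_le] at hf ⊢
  intro n hn t ht A B hA hB sA sB
  have hAB : IsSelfAdjoint (t • A + (1 - t) • B) := isSelfAdjoint_smul_add_smul hA hB t
  rw [cfc_const_add c f A (continuousOn_spectrum_real f A) hA,
    cfc_const_add c f B (continuousOn_spectrum_real f B) hB,
    cfc_const_add c f _ (continuousOn_spectrum_real f _) hAB]
  calc algebraMap ℝ _ c + cfc f (t • A + (1 - t) • B)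
      ≤ algebraMap ℝ _ c + (t • cfc f A + (1 - t) • cfc f B) := by
        gcongr
        exact hf n hn t ht A B hA hB sA sB
    _ = _ := by
        rw [Algebra.algebraMap_eq_smul_one]
        module

theorem operatorConvexOn_inv {a : ℝ} (ha : 0 < a) :
    OperatorConvexOn (fun x => x⁻¹) (Set.Ici a) := by
  rw [operatorConvexOn_iff_cfc_le]
  intro n hn t ht A B hA hB sA sB
  have hA' := isStrictlyPositive_of_spectrum_subset hA ha sA
  have hB' := isStrictlyPositive_of_spectrum_subset hB ha sB
  have hconv := CStarAlgebra.convexOn_ringInverse (A := Matrix (Fin n) (Fin n) ℂ)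
  have hAB : IsStrictlyPositive (t • A + (1 - t) • B) :=
    hconv.1 hA' hB' ht.1 (sub_nonneg.2 ht.2) (by ring)
  rw [cfc_ringInverse_id A hA'.isUnit hA, cfc_ringInverse_id B hB'.isUnit hB,
    cfc_ringInverse_id _ hAB.isUnit hAB.isSelfAdjoint]
  exact hconv.2 hA' hB' ht.1 (sub_nonneg.2 ht.2) (by ring)

theorem operatorConvexOn_sq (I : Set ℝ) : OperatorConvexOn (fun x => x ^ 2) I := by
  rw [operatorConvexOn_iff_cfc_le]
  intro n hn t ht A B hA hB _ _
  have hAB : IsSelfAdjoint (t • A + (1 - t) • B) := isSelfAdjoint_smul_add_smul hA hB t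
  rw [cfc_pow_id A 2 hA, cfc_pow_id B 2 hB, cfc_pow_id _ 2 hAB, ← sub_nonneg]
  have h : t • A ^ 2 + (1 - t) • B ^ 2 - (t • A + (1 - t) • B) ^ 2 =
      (t * (1 - t)) • (star (A - B) * (A - B)) := by
    rw [(hA.sub hB).star_eq]
    simp only [pow_two, mul_add, add_mul, mul_sub, sub_mul, smul_mul_assoc, mul_smul_comm]
    module
  rw [h]
  exact smul_nonneg (mul_nonneg ht.1 (sub_nonneg.2 ht.2)) (star_mul_self_nonneg _)

/-- If composing `φ` with every operator convex function `c + x ^ 2` whose values lie in `I`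
yields an operator convex function, then `φ` is monotone on `I` as a scalar function. -/
theorem monotoneOn_of_comp_const_add_sq {I : Set ℝ} (hI : Convex ℝ I) {φ : ℝ → ℝ}
    (h : ∀ J : Set ℝ, Convex ℝ J → J.Nontrivial → ∀ c : ℝ,
      (fun x => c + x ^ 2) '' J ⊆ I → OperatorConvexOn (φ ∘ fun x => c + x ^ 2) J) :
    MonotoneOn φ I := by
  intro x hx y hy hxy
  obtain rfl | hlt := hxy.eq_or_lt
  · rfl
  have hs : 0 < √(y - x) := Real.sqrt_pos.2 (sub_pos.2 hlt)
  have hsq : √(y - x) ^ 2 = y - x := Real.sq_sqrt (sub_nonneg.2 hxy)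
  set s := √(y - x)
  have hJ : (fun z => x + z ^ 2) '' Set.Icc (-s) s ⊆ I := by
    rintro _ ⟨z, hz, rfl⟩
    refine hI.ordConnected.out hx hy ⟨?_, ?_⟩
    · nlinarith [sq_nonneg z]
    · nlinarith [sq_le_sq' hz.1 hz.2]
  have hc := h (Set.Icc (-s) s) (convex_Icc _ _)
    ⟨-s, ⟨le_rfl, by linarith⟩, s, ⟨by linarith, le_rfl⟩, by linarith⟩ x hJ
  rw [operatorConvexOn_iff_cfc_le] at hc
  let a (r : ℝ) : Matrix (Fin 1) (Fin 1) ℂ := algebraMap ℝ _ r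
  have hsp (r : ℝ) (hr : r ∈ Set.Icc (-s) s) : spectrum ℝ (a r) ⊆ Set.Icc (-s) s := by
    rw [spectrum.scalar_eq]
    exact Set.singleton_subset_iff.2 hr
  have hle := hc 1 one_pos (1 / 2) (by norm_num) (a s) (a (-s)) (.algebraMap _ (.all s))
    (.algebraMap _ (.all _)) (hsp s ⟨by linarith, le_rfl⟩) (hsp (-s) ⟨le_rfl, by linarith⟩)
  have h0 : (1 / 2 : ℝ) • a s + (1 - 1 / 2 : ℝ) • a (-s) = a 0 := by
    simp only [a, Algebra.algebraMap_eq_smul_one]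
    module
  have h1 : (1 / 2 : ℝ) • a (φ y) + (1 - 1 / 2 : ℝ) • a (φ y) = a (φ y) := by module
  rw [h0] at hle
  simp only [a, cfc_algebraMap, Function.comp_apply, neg_sq, hsq, add_sub_cancel, ne_eq,
    OfNat.ofNat_ne_zero, not_false_eq_true, zero_pow, add_zero] at hle h1
  rw [h1] at hle
  have hsub := (spectrum_subset_Icc_iff (.algebraMap _ (.all _))).2 ⟨hle, le_rfl⟩
  rw [spectrum.scalar_eq, Set.singleton_subset_iff] at hsub
  exact hsub.1

/-- Approximate operator monotonicity: if `φ` is bounded by `c` on `(l, u]` and `x ↦ φ (l + x⁻¹)`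
is operator convex on `[(u - l)⁻¹, ∞)`, then `A ≤ B` implies `φ(A) ≤ t φ(B) + (1 - t) c`. -/
theorem cfc_le_smul_add_of_operatorConvexOn_comp_inv (hn : 0 < n) {φ : ℝ → ℝ} {l u c : ℝ}
    (hlu : l < u) (hc : ∀ x ∈ Set.Ioc l u, φ x ≤ c)
    (hφ : OperatorConvexOn (φ ∘ fun x => l + x⁻¹) (Set.Ici (u - l)⁻¹)) {A B : Mat}
    (hA : IsSelfAdjoint A) (hB : IsSelfAdjoint B) (sA : spectrum ℝ A ⊆ Set.Ioc l u)
    (sB : spectrum ℝ B ⊆ Set.Ioc l u) (hAB : A ≤ B) {t : ℝ} (ht : t ∈ Set.Ico (0 : ℝ) 1) :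
    cfc φ A ≤ t • cfc φ B + (1 - t) • algebraMap ℝ Mat c := by
  rw [operatorConvexOn_iff_cfc_le] at hφ
  have hul : 0 < u - l := sub_pos.2 hlu
  have key {X : Mat} (hX : IsSelfAdjoint X) (sX : spectrum ℝ X ⊆ Set.Ioc l u) :
      IsStrictlyPositive (X - algebraMap ℝ Mat l) ∧
      cfc (fun x => (x - l)⁻¹) X = Ring.inverse (X - algebraMap ℝ Mat l) ∧
      spectrum ℝ (cfc (fun x => (x - l)⁻¹) X) ⊆ Set.Ici (u - l)⁻¹ ∧
      cfc (φ ∘ fun x => l + x⁻¹) (cfc (fun x => (x - l)⁻¹) X) = cfc φ X := by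
    have hsub : cfc (fun x => x - l) X = X - algebraMap ℝ Mat l := by
      rw [cfc_sub (fun x => x) (fun _ => l) X (by fun_prop) (by fun_prop), cfc_id' ℝ X hX,
        cfc_const l X hX]
    have hpos : ∀ x ∈ spectrum ℝ X, 0 < x - l := fun x hx => sub_pos.2 (sX hx).1
    refine ⟨?_, ?_, ?_, ?_⟩
    · rw [← hsub]
      exact (cfc_isStrictlyPositive_iff _ X (by fun_prop) hX).2 hpos
    · rw [cfc_inv (fun x => x - l) X (fun x hx => (hpos x hx).ne') (by fun_prop) hX, hsub]
    · rw [cfc_map_spectrum (fun x : ℝ => (x - l)⁻¹) X hX (continuousOn_spectrum_real _ X)]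
      rintro _ ⟨x, hx, rfl⟩
      have := (sX hx).2
      exact inv_anti₀ (hpos x hx) (by linarith)
    · rw [← cfc_comp_matrix _ _ hX]
      refine cfc_congr fun x _ => ?_
      simp
  obtain ⟨pA, eA, iA, fA⟩ := key hA sA
  obtain ⟨-, eB, iB, fB⟩ := key hB sB
  set A' := cfc (fun x => (x - l)⁻¹) A
  set B' := cfc (fun x => (x - l)⁻¹) B
  have hA' : IsSelfAdjoint A' := cfc_predicate _ A
  have hB' : IsSelfAdjoint B' := cfc_predicate _ B
  have hBA : B' ≤ A' := by
    rw [eA, eB]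
    exact CStarAlgebra.ringInverse_le_ringInverse (sub_le_sub_right hAB _) pA
  have ht' : 0 < 1 - t := sub_pos.2 ht.2
  set C := B' + (1 - t)⁻¹ • (A' - B') with hC_def
  have hC : IsSelfAdjoint C := hB'.add ((IsSelfAdjoint.all _).smul (hA'.sub hB'))
  have hBC : B' ≤ C :=
    le_add_of_nonneg_right (smul_nonneg (inv_nonneg.2 ht'.le) (sub_nonneg.2 hBA))
  have sC : spectrum ℝ C ⊆ Set.Ici (u - l)⁻¹ :=
    (algebraMap_le_iff_le_spectrum hC).1 (((algebraMap_le_iff_le_spectrum hB').2 iB).trans hBC)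
  have hcomb : t • B' + (1 - t) • C = A' := by
    rw [hC_def, smul_add, smul_inv_smul₀ ht'.ne']
    module
  have hle := hφ n hn t ⟨ht.1, ht.2.le⟩ B' C hB' hC iB sC
  rw [hcomb, fA, fB] at hle
  refine hle.trans ?_
  gcongr
  refine cfc_le_algebraMap _ c C (fun x hx => hc _ ?_) (continuousOn_spectrum_real _ C) hC
  have hx' : (u - l)⁻¹ ≤ x := sC hx
  have hx0 : 0 < x := (inv_pos.2 hul).trans_le hx'
  have := inv_le_of_inv_le₀ hul hx'
  exact ⟨by linarith [inv_pos.2 hx0], by linarith⟩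

theorem cfc_le_cfc_of_operatorConvexOn_comp_inv (hn : 0 < n) {φ : ℝ → ℝ} {l u : ℝ}
    (hlu : l < u) (hmono : MonotoneOn φ (Set.Icc l u)) (hφ : OperatorConvexOn φ (Set.Icc l u))
    (hinv : OperatorConvexOn (φ ∘ fun x => l + x⁻¹) (Set.Ici (u - l)⁻¹)) {A B : Mat}
    (hA : IsSelfAdjoint A) (hB : IsSelfAdjoint B) (sA : spectrum ℝ A ⊆ Set.Icc l u)
    (sB : spectrum ℝ B ⊆ Set.Icc l u) (hAB : A ≤ B) : cfc φ A ≤ cfc φ B := by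
  rw [operatorConvexOn_iff_cfc_le] at hφ
  set U := algebraMap ℝ Mat u
  have hU : IsSelfAdjoint U := .algebraMap _ (.all u)
  have hbound : ∀ t ∈ Set.Ioo (0 : ℝ) 1,
      cfc φ A ≤ t • (t • cfc φ B + (1 - t) • algebraMap ℝ Mat (φ u)) +
        (1 - t) • algebraMap ℝ Mat (φ u) := by
    intro t ht
    have ht' : 0 < 1 - t := sub_pos.2 ht.2
    have key {X : Mat} (hX : IsSelfAdjoint X) (sX : spectrum ℝ X ⊆ Set.Icc l u) :
        t • X + (1 - t) • U = cfc (fun x => t * x + (1 - t) * u) X ∧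
        spectrum ℝ (t • X + (1 - t) • U) ⊆ Set.Ioc l u := by
      have heq : t • X + (1 - t) • U = cfc (fun x => t * x + (1 - t) * u) X := by
        rw [cfc_add_const ((1 - t) * u) (fun x => t * x) X (by fun_prop) hX,
          cfc_const_mul_id t X hX, Algebra.algebraMap_eq_smul_one, mul_smul,
          ← Algebra.algebraMap_eq_smul_one]
      refine ⟨heq, ?_⟩
      rw [heq, cfc_map_spectrum (fun x : ℝ => t * x + (1 - t) * u) X hX
        (continuousOn_spectrum_real _ X)]
      rintro _ ⟨x, hx, rfl⟩
      obtain ⟨h1, h2⟩ := sX hx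
      exact ⟨by nlinarith [ht.1], by nlinarith [ht.1]⟩
    obtain ⟨eA, iA⟩ := key hA sA
    obtain ⟨-, iB⟩ := key hB sB
    have hle : t • A + (1 - t) • U ≤ t • B + (1 - t) • U := by
      gcongr
      exact ht.1.le
    calc cfc φ A ≤ cfc φ (t • A + (1 - t) • U) := by
          rw [eA, ← cfc_comp_matrix _ _ hA]
          refine cfc_mono (fun x hx => ?_) (continuousOn_spectrum_real _ A)
            (continuousOn_spectrum_real _ A)
          obtain ⟨h1, h2⟩ := sA hx
          refine hmono ⟨h1, h2⟩ ⟨?_, ?_⟩ ?_ <;> nlinarith [ht.1]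
      _ ≤ t • cfc φ (t • B + (1 - t) • U) + (1 - t) • algebraMap ℝ Mat (φ u) :=
          cfc_le_smul_add_of_operatorConvexOn_comp_inv hn hlu
            (fun x hx => hmono (Set.Ioc_subset_Icc_self hx) ⟨hlu.le, le_rfl⟩ hx.2) hinv
            (isSelfAdjoint_smul_add_smul hA hU t)
            (isSelfAdjoint_smul_add_smul hB hU t)
            iA iB hle ⟨ht.1.le, ht.2⟩
      _ ≤ _ := by
          have := hφ n hn t ⟨ht.1.le, ht.2.le⟩ B U hB hU sB
            ((spectrum_subset_Icc_iff hU).2 ⟨algebraMap_mono _ hlu.le, le_rfl⟩)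
          rw [cfc_algebraMap] at this
          gcongr
          exact ht.1.le
  have hlim : Filter.Tendsto (fun t : ℝ => t • (t • cfc φ B + (1 - t) • algebraMap ℝ Mat (φ u)) +
      (1 - t) • algebraMap ℝ Mat (φ u)) (nhdsWithin 1 (Set.Iio 1)) (nhds (cfc φ B)) := by
    have hcont : Continuous fun t : ℝ =>
        t • (t • cfc φ B + (1 - t) • algebraMap ℝ Mat (φ u)) +
          (1 - t) • algebraMap ℝ Mat (φ u) := by fun_prop
    simpa using (hcont.tendsto 1).mono_left nhdsWithin_le_nhds
  refine ge_of_tendsto hlim ?_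
  filter_upwards [Ioo_mem_nhdsLT (zero_lt_one' ℝ)] with t ht using hbound t ht

theorem exists_Icc_subset_of_finite {I s : Set ℝ} (hI : Convex ℝ I) (hnt : I.Nontrivial)
    (hs : s.Finite) (hsI : s ⊆ I) : ∃ l u, l < u ∧ s ⊆ Set.Icc l u ∧ Set.Icc l u ⊆ I := by
  obtain ⟨p, hp, q, hq, hpq⟩ := hnt.exists_lt
  have hfin : (insert p (insert q s)).Finite := (hs.insert q).insert p
  have hne : (insert p (insert q s)).Nonempty := ⟨p, Set.mem_insert _ _⟩
  obtain ⟨l, hl, hl'⟩ := Set.exists_min_image _ id hfin hne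
  obtain ⟨u, hu, hu'⟩ := Set.exists_max_image _ id hfin hne
  have hsub : insert p (insert q s) ⊆ I :=
    Set.insert_subset hp (Set.insert_subset hq hsI)
  refine ⟨l, u, ?_, fun x hx => ⟨hl' x (by simp [hx]), hu' x (by simp [hx])⟩,
    hI.ordConnected.out (hsub hl) (hsub hu)⟩
  exact ((hl' p (by simp)).trans_lt hpq).trans_le (hu' q (by simp))

theorem OperatorConvexOn.mono {f : ℝ → ℝ} {I J : Set ℝ} (hf : OperatorConvexOn f J)
    (hIJ : I ⊆ J) : OperatorConvexOn f I :=
  fun n hn t ht A B hA hB hAB sA sB =>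
    hf n hn t ht A B hA hB hAB (fun i => hIJ (sA i)) (fun i => hIJ (sB i))

theorem operatorMonotoneOn_of_comp {I : Set ℝ} (hI : Convex ℝ I) (hnt : I.Nontrivial) {φ : ℝ → ℝ}
    (hφ : OperatorConvexOn φ I) (hmono : MonotoneOn φ I)
    (hinv : ∀ J : Set ℝ, Convex ℝ J → J.Nontrivial → ∀ l : ℝ,
      OperatorConvexOn (fun x => l + x⁻¹) J → (fun x => l + x⁻¹) '' J ⊆ I →
      OperatorConvexOn (φ ∘ fun x => l + x⁻¹) J) :
    OperatorMonotoneOn φ I := by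
  intro n hn A B hA hB sA sB hAB
  rw [forall_eigenvalues_mem_iff] at sA sB
  rw [← Matrix.IsHermitian.cfc_eq, ← Matrix.IsHermitian.cfc_eq]
  obtain ⟨l, u, hlu, hs, hluI⟩ := exists_Icc_subset_of_finite hI hnt
    (A.finite_real_spectrum.union B.finite_real_spectrum) (Set.union_subset sA sB)
  have hul : 0 < u - l := sub_pos.2 hlu
  refine cfc_le_cfc_of_operatorConvexOn_comp_inv hn hlu (hmono.mono hluI) (hφ.mono hluI) ?_ hA hB
    (Set.subset_union_left.trans hs) (Set.subset_union_right.trans hs) hAB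
  refine hinv _ (convex_Ici _) ⟨_, Set.self_mem_Ici, _, (lt_add_one (u - l)⁻¹).le,
    (lt_add_one (u - l)⁻¹).ne⟩ l ((operatorConvexOn_inv (inv_pos.2 hul)).const_add l) ?_
  rintro _ ⟨x, hx, rfl⟩
  have hx0 : 0 < x := (inv_pos.2 hul).trans_le hx
  have := inv_le_of_inv_le₀ hul hx
  exact hluI ⟨by linarith [inv_pos.2 hx0], by linarith⟩

end Loewner

/-- Proposition 0.4: if `φ∘f` is operator convex on `J` for every nondegenerate
interval `J` and every operator convex `f` on `J` with `f(J) ⊆ I`, then `φ` is operator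
monotone and operator convex on `I`. -/
theorem stmt7 (I : Set ℝ) (hI : Convex ℝ I) (hnt : I.Nontrivial) (φ : ℝ → ℝ)
    (h : ∀ (J : Set ℝ), Convex ℝ J → J.Nontrivial → ∀ f : ℝ → ℝ,
      OperatorConvexOn f J → f '' J ⊆ I → OperatorConvexOn (φ ∘ f) J) :
    OperatorMonotoneOn φ I ∧ OperatorConvexOn φ I := by
  have hφ : OperatorConvexOn φ I := h I hI hnt id (operatorConvexOn_id I) (by simp)
  have hmono : MonotoneOn φ I := monotoneOn_of_comp_const_add_sq hI fun J hJ hJnt c hc =>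
    h J hJ hJnt _ ((operatorConvexOn_sq J).const_add c) hc
  exact ⟨operatorMonotoneOn_of_comp hI hnt hφ hmono fun J hJ hJnt l => h J hJ hJnt _, hφ⟩
end
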